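/- arXiv:math/0401444 — 6 statements merged into one kernel-verified Lean document; each statement's English description precedes it below -/
import Mathlib

section
/- Let A₁,…,A_d : ℝ^P → M_N(ℂ) be smooth with A_d(p) invertible for every p, and suppose there is a smooth map S : ℝ^P → M_N(ℂ) with S(p) Hermitian positive definite and S(p)A_j(p) Hermitian for all j and p (Friedrichs symmetric hyperbolicity). Write ω = (η,ξ) ∈ ℝ^{d−1}×ℝ, A(p,ω) := Σ_{j<d} η_j A_j(p) + ξ A_d(p), Δ(p,τ,ω) := det(τI + A(p,ω)), and for ζ = (τ,η,γ) set G(p,ζ) := A_d(p)^{−1}((τ−iγ)I + Σ_{j<d} η_j A_j(p)). Fix p̄ and assume that every real characteristic root (τ̄,ω̄) at p̄ (i.e. τ̄ ∈ ℝ, ω̄ ∈ ℝ^d \ {0} with Δ(p̄,τ̄,ω̄) = 0), of multiplicity m as a root of τ ↦ Δ(p̄,τ,ω̄), is either geometrically regular or totally nonglancing. Let M(p,ζ) be a matrix with N columns depending smoothly on (p,ζ) for ζ ≠ 0 and homogeneous of degree 0 in ζ, and assume the uniform Lopatinski condition: there are a neighborhood ω₀ of p̄ and C > 0 such that |h| ≤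 C|M(p,ζ)h| for every p ∈ ω₀, every ζ = (τ,η,γ) with γ > 0, and every h in the stable subspace E_-(G(p,ζ)). Then the maximal estimate holds: there exist a neighborhood ω₁ of p̄ and K > 0 such that for all p ∈ ω₁, all ζ with γ > 0 and |ζ| = 1, every f ∈ L²((0,∞);ℂ^N), and every continuously differentiable u : [0,∞) → ℂ^N lying in L²((0,∞);ℂ^N) and satisfying u′(x) + iG(p,ζ)u(x) = f(x) for x > 0, one has γ‖u‖²_{L²((0,∞))} + |u(0)|² ≤ K(γ^{−1}‖f‖²_{L²((0,∞))} + |M(p,ζ)u(0)|²). -/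
open MeasureTheory
open scoped ComplexOrder
/-- The spatial symbol `A(p,ω) = Σ_{j<d} η_j A_j(p) + ξ A_d(p)`, with `ω = (η,ξ)`. -/
noncomputable def Asym {P N d : ℕ} (A : Fin d → (Fin P → ℝ) → Matrix (Fin N) (Fin N) ℂ)
    (Ad : (Fin P → ℝ) → Matrix (Fin N) (Fin N) ℂ)
    (p : Fin P → ℝ) (ω : (Fin d → ℝ) × ℝ) : Matrix (Fin N) (Fin N) ℂ :=
  (∑ j, (ω.1 j : ℂ) • A j p) + (ω.2 : ℂ) • Ad p

/-- The characteristic determinant `Δ(p,τ,ω) = det(τI + A(p,ω))`. -/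
noncomputable def charDet {P N d : ℕ} (A : Fin d → (Fin P → ℝ) → Matrix (Fin N) (Fin N) ℂ)
    (Ad : (Fin P → ℝ) → Matrix (Fin N) (Fin N) ℂ)
    (p : Fin P → ℝ) (τ : ℝ) (ω : (Fin d → ℝ) × ℝ) : ℂ :=
  ((τ : ℂ) • (1 : Matrix (Fin N) (Fin N) ℂ) + Asym A Ad p ω).det

/-- The boundary symbol `G(p,ζ) = A_d(p)⁻¹((τ−iγ)I + Σ_{j<d} η_j A_j(p))`, with
`ζ = (τ,η,γ)`. -/
noncomputable def bdrySymbol {P N d : ℕ} (A : Fin d → (Fin P → ℝ) → Matrix (Fin N) (Fin N) ℂ)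
    (Ad : (Fin P → ℝ) → Matrix (Fin N) (Fin N) ℂ)
    (p : Fin P → ℝ) (ζ : ℝ × (Fin d → ℝ) × ℝ) : Matrix (Fin N) (Fin N) ℂ :=
  (Ad p)⁻¹ * (((ζ.1 : ℂ) - Complex.I * (ζ.2.2 : ℂ)) • (1 : Matrix (Fin N) (Fin N) ℂ)
    + ∑ j, (ζ.2.1 j : ℂ) • A j p)

/-- The stable subspace `E₋(G)`: the sum of the generalized eigenspaces of `G` associated
with eigenvalues `μ` with `Im μ < 0`. -/
noncomputable def stableSubspace {N : ℕ} (G : Matrix (Fin N) (Fin N) ℂ) :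
    Submodule ℂ (EuclideanSpace ℂ (Fin N)) :=
  ⨆ μ ∈ {μ : ℂ | μ.im < 0}, ⨆ k : ℕ,
    LinearMap.ker ((Matrix.toEuclideanLin G - μ • 1) ^ k)

/-- The characteristic polynomial `Δ(p̄,·)` at a frozen parameter, as a multivariate
polynomial in `(τ, η₁,…,η_{d−1}, ξ)`: variable `0` is `τ`, variable `j.castSucc.succ` is
`η_j`, the last variable is `ξ`. -/
noncomputable def charMvPolyBdry {N d : ℕ} (B : Fin d → Matrix (Fin N) (Fin N) ℂ)
    (Bd : Matrix (Fin N) (Fin N) ℂ) : MvPolynomial (Fin (d + 2)) ℂ :=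
  ((MvPolynomial.X 0 : MvPolynomial (Fin (d + 2)) ℂ)
      • (1 : Matrix (Fin N) (Fin N) (MvPolynomial (Fin (d + 2)) ℂ))
    + ∑ j : Fin d, (MvPolynomial.X j.castSucc.succ : MvPolynomial (Fin (d + 2)) ℂ)
      • (B j).map (fun z => MvPolynomial.C z)
    + (MvPolynomial.X (Fin.last (d + 1)) : MvPolynomial (Fin (d + 2)) ℂ)
      • Bd.map (fun z => MvPolynomial.C z)).det

/-- The homogeneous degree-`m` Taylor term of `Δ(p̄,·)` at the real point `(tb, hb, xb)`. -/
noncomputable def taylorTermBdry {N d : ℕ} (B : Fin d → Matrix (Fin N) (Fin N) ℂ)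
    (Bd : Matrix (Fin N) (Fin N) ℂ) (tb : ℝ) (hb : Fin d → ℝ) (xb : ℝ) (m : ℕ) :
    MvPolynomial (Fin (d + 2)) ℂ :=
  MvPolynomial.homogeneousComponent m
    (MvPolynomial.bind₁
      (fun i => MvPolynomial.X i
        + MvPolynomial.C ((Fin.cons (tb : ℂ) (Fin.snoc (fun j => (hb j : ℂ)) (xb : ℂ))
            : Fin (d + 2) → ℂ) i))
      (charMvPolyBdry B Bd))

/-- The multiplicity of `tb` as a root of `τ ↦ Δ(p̄, τ, (hb, xb))`. -/
noncomputable def multAt {N d : ℕ} (B : Fin d → Matrix (Fin N) (Fin N) ℂ)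
    (Bd : Matrix (Fin N) (Fin N) ℂ) (tb : ℝ) (hb : Fin d → ℝ) (xb : ℝ) : ℕ :=
  Polynomial.rootMultiplicity (tb : ℂ)
    (MvPolynomial.aeval
      ((Fin.cons (Polynomial.X : Polynomial ℂ)
        (Fin.snoc (fun j => Polynomial.C ((hb j : ℂ))) (Polynomial.C ((xb : ℂ)))))
        : Fin (d + 2) → Polynomial ℂ)
      (charMvPolyBdry B Bd))

/-- A real characteristic root `(tb, ω̄)` at `p̄`, of multiplicity `m`, is *geometrically
regular* if on a neighborhood of `(p̄, ω̄)` one has `Δ = e·∏_{j=1}^m (τ + λ_j)` with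
`λ_j` smooth real-valued and real-analytic in `ω`, `e` a polynomial in `τ` with smooth
coefficients not vanishing at the base point, together with `m` smooth eigenvector fields
`e_j`, real-analytic in `ω` and everywhere linearly independent, with
`A(p,ω) e_j = λ_j e_j`. -/
def GeomRegular {P N d : ℕ} (A : Fin d → (Fin P → ℝ) → Matrix (Fin N) (Fin N) ℂ)
    (Ad : (Fin P → ℝ) → Matrix (Fin N) (Fin N) ℂ)
    (p0 : Fin P → ℝ) (tb : ℝ) (ω0 : (Fin d → ℝ) × ℝ) (m : ℕ) : Prop :=
  ∃ U : Set ((Fin P → ℝ) × ((Fin d → ℝ) × ℝ)), IsOpen U ∧ (p0, ω0) ∈ U ∧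
  ∃ lam : Fin m → ((Fin P → ℝ) × ((Fin d → ℝ) × ℝ)) → ℝ,
  ∃ ev : Fin m → ((Fin P → ℝ) × ((Fin d → ℝ) × ℝ)) → (Fin N → ℂ),
  ∃ K : ℕ, ∃ coef : Fin K → ((Fin P → ℝ) × ((Fin d → ℝ) × ℝ)) → ℂ,
    (∀ j, ContDiffOn ℝ (⊤ : ℕ∞) (lam j) U) ∧
    (∀ j, ∀ q ∈ U, AnalyticAt ℝ (fun ω => lam j (q.1, ω)) q.2) ∧
    (∀ j i, ContDiffOn ℝ (⊤ : ℕ∞) (fun q => ev j q i) U) ∧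
    (∀ j i, ∀ q ∈ U, AnalyticAt ℝ (fun ω => ev j (q.1, ω) i) q.2) ∧
    (∀ k, ContDiffOn ℝ (⊤ : ℕ∞) (coef k) U) ∧
    (∀ q ∈ U, ∀ τ : ℝ, charDet A Ad q.1 τ q.2
      = (∑ k, coef k q * (τ : ℂ) ^ (k : ℕ)) * ∏ j, ((τ : ℂ) + (lam j q : ℂ))) ∧
    (∑ k, coef k (p0, ω0) * (tb : ℂ) ^ (k : ℕ)) ≠ 0 ∧
    (∀ q ∈ U, ∀ j, (Asym A Ad q.1 q.2).mulVec (ev j q) = (lam j q : ℂ) • ev j q) ∧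
    (∀ q ∈ U, LinearIndependent ℂ (fun j => ev j q))

/-- A real characteristic root `(tb, ω̄)` at `p̄` is *totally nonglancing* if, with `Δ̄` the
homogeneous degree-`m` Taylor term (`m` the multiplicity) of `Δ(p̄,·)` at the root, either
`dx = (0,…,0,1)` or `−dx` lies in the connected component `Γ₊` of `{Δ̄ > 0}` containing
`dt = (1,0,…,0)`. -/
def TotallyNonglancing {P N d : ℕ} (A : Fin d → (Fin P → ℝ) → Matrix (Fin N) (Fin N) ℂ)
    (Ad : (Fin P → ℝ) → Matrix (Fin N) (Fin N) ℂ)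
    (p0 : Fin P → ℝ) (tb : ℝ) (ω0 : (Fin d → ℝ) × ℝ) : Prop :=
  (Fin.cons (0:ℝ) (Fin.snoc (0 : Fin d → ℝ) (1:ℝ)) : Fin (d + 2) → ℝ) ∈
    connectedComponentIn
      {x : Fin (d + 2) → ℝ |
        (MvPolynomial.eval (fun i => (x i : ℂ))
          (taylorTermBdry (fun j => A j p0) (Ad p0) tb ω0.1 ω0.2
            (multAt (fun j => A j p0) (Ad p0) tb ω0.1 ω0.2))).im = 0 ∧
        0 < (MvPolynomial.eval (fun i => (x i : ℂ))
          (taylorTermBdry (fun j => A j p0) (Ad p0) tb ω0.1 ω0.2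
            (multAt (fun j => A j p0) (Ad p0) tb ω0.1 ω0.2))).re}
      (Fin.cons 1 0) ∨
  (Fin.cons (0:ℝ) (Fin.snoc (0 : Fin d → ℝ) (-1:ℝ)) : Fin (d + 2) → ℝ) ∈
    connectedComponentIn
      {x : Fin (d + 2) → ℝ |
        (MvPolynomial.eval (fun i => (x i : ℂ))
          (taylorTermBdry (fun j => A j p0) (Ad p0) tb ω0.1 ω0.2
            (multAt (fun j => A j p0) (Ad p0) tb ω0.1 ω0.2))).im = 0 ∧
        0 < (MvPolynomial.eval (fun i => (x i : ℂ))
          (taylorTermBdry (fun j => A j p0) (Ad p0) tb ω0.1 ω0.2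
            (multAt (fun j => A j p0) (Ad p0) tb ω0.1 ω0.2))).re}
      (Fin.cons 1 0)

section Helpers

open Filter Topology Asymptotics

variable {E : Type*} [NormedAddCommGroup E] [InnerProductSpace ℂ E]

/-- The span of the generalized eigenvectors with eigenvalues in the open lower half plane. -/
noncomputable def lowerSpectralSubspace (T : Module.End ℂ E) : Submodule ℂ E :=
  ⨆ μ ∈ {μ : ℂ | μ.im < 0}, ⨆ k : ℕ, LinearMap.ker ((T - μ • 1) ^ k)

/-- Initial values of exponentially decaying solutions of `w' = -iTw`. -/
def decayingData (T : Module.End ℂ E) : Submodule ℂ E where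
  carrier := {h | ∃ w : ℝ → E, w 0 = h ∧ (∀ x, HasDerivAt w (-(Complex.I • T (w x))) x) ∧
    ∃ b > (0 : ℝ), w =O[atTop] fun x => Real.exp (-b * x)}
  zero_mem' := ⟨fun _ => 0, rfl, fun x => by simpa using hasDerivAt_const x (0 : E), 1, one_pos,
    isBigO_zero _ _⟩
  add_mem' := by
    rintro _ _ ⟨w, rfl, hw, b, hb, hwb⟩ ⟨v, rfl, hv, c, hc, hvc⟩
    refine ⟨fun x => w x + v x, rfl, fun x => ?_, min b c, lt_min hb hc, ?_⟩
    · refine ((hw x).add (hv x)).congr_deriv ?_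
      rw [map_add]
      module
    · have key : ∀ r, min b c ≤ r →
          (fun x : ℝ => Real.exp (-r * x)) =O[atTop] fun x => Real.exp (-(min b c) * x) := by
        intro r hr
        refine IsBigO.of_bound 1 ?_
        filter_upwards [eventually_ge_atTop (0 : ℝ)] with x hx
        rw [Real.norm_eq_abs, Real.norm_eq_abs, Real.abs_exp, Real.abs_exp, one_mul,
          Real.exp_le_exp]
        nlinarith
      exact (hwb.trans (key _ (min_le_left _ _))).add (hvc.trans (key _ (min_le_right _ _)))
  smul_mem' := by
    rintro a _ ⟨w, rfl, hw, b, hb, hwb⟩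
    refine ⟨fun x => a • w x, rfl, fun x => ?_, b, hb, hwb.const_smul_left a⟩
    refine ((hw x).const_smul a).congr_deriv ?_
    rw [map_smul]
    module

lemma exp_polynomial_hasDerivAt (T : Module.End ℂ E) (μ : ℂ) (h : E) (k : ℕ) (x : ℝ) :
    HasDerivAt (fun x : ℝ => Complex.exp (-Complex.I * μ * x) • ∑ j ∈ Finset.range (k + 1),
        ((-Complex.I * x) ^ j / (j.factorial : ℂ)) • ((T - μ • 1) ^ j) h)
      (-(Complex.I • T (Complex.exp (-Complex.I * μ * x) • ∑ j ∈ Finset.range (k + 1),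
        ((-Complex.I * x) ^ j / (j.factorial : ℂ)) • ((T - μ • 1) ^ j) h)) +
        Complex.exp (-Complex.I * μ * x) • Complex.I • ((-Complex.I * x) ^ k / (k.factorial : ℂ)) •
          ((T - μ • 1) ^ (k + 1)) h) x := by
  have hlin : ∀ c : ℂ, HasDerivAt (fun x : ℝ => c * (x : ℂ)) c x := fun c => by
    simpa using (Complex.ofRealCLM.hasDerivAt (x := x)).const_mul c
  have hexp : HasDerivAt (fun x : ℝ => Complex.exp (-Complex.I * μ * x))
      (Complex.exp (-Complex.I * μ * x) * (-Complex.I * μ)) x := (hlin _).cexp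
  have hsum : HasDerivAt (fun x : ℝ => ∑ j ∈ Finset.range (k + 1),
        ((-Complex.I * x) ^ j / (j.factorial : ℂ)) • ((T - μ • 1) ^ j) h)
      (-(Complex.I • (T - μ • 1) (∑ j ∈ Finset.range (k + 1),
        ((-Complex.I * x) ^ j / (j.factorial : ℂ)) • ((T - μ • 1) ^ j) h)) +
        Complex.I • ((-Complex.I * x) ^ k / (k.factorial : ℂ)) •
          ((T - μ • 1) ^ (k + 1)) h) x := by
    induction k with
    | zero => simpa using hasDerivAt_const x h
    | succ k ih =>
      have hp := (((hlin (-Complex.I)).pow (k + 1)).div_const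
        (((k + 1).factorial : ℕ) : ℂ)).smul_const (((T - μ • 1) ^ (k + 1)) h)
      refine ((ih.add hp).congr_of_eventuallyEq (Eventually.of_forall fun y =>
        Finset.sum_range_succ _ (k + 1))).congr_deriv ?_
      rw [Finset.sum_range_succ _ (k + 1)]
      have hf : ((k.factorial : ℕ) : ℂ) ≠ 0 := by exact_mod_cast k.factorial_ne_zero
      have hk : ((k : ℂ) + 1) ≠ 0 := by exact_mod_cast k.succ_ne_zero
      have hT : ((T - μ • 1) ^ (k + 1 + 1)) h = (T - μ • 1) (((T - μ • 1) ^ (k + 1)) h) := by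
        rw [pow_succ' _ (k + 1)]; rfl
      have hc : (((k + 1 : ℕ) : ℂ) * (-Complex.I * (x : ℂ)) ^ (k + 1 - 1) * -Complex.I) /
          (((k + 1).factorial : ℕ) : ℂ) =
          -(Complex.I * ((-Complex.I * x) ^ k / (k.factorial : ℂ))) := by
        rw [Nat.factorial_succ]; push_cast
        field_simp
      rw [map_add, map_smul, hc, hT]
      module
  refine (hexp.smul hsum).congr_deriv ?_
  generalize (∑ j ∈ Finset.range (k + 1),
        ((-Complex.I * x) ^ j / (j.factorial : ℂ)) • ((T - μ • 1) ^ j) h) = z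
  simp only [map_smul, LinearMap.sub_apply, LinearMap.smul_apply, Module.End.one_apply]
  module

lemma ker_pow_le_decayingData (T : Module.End ℂ E) {μ : ℂ} (hμ : μ.im < 0) (k : ℕ) :
    LinearMap.ker ((T - μ • 1) ^ k) ≤ decayingData T := by
  intro h hh
  have hh' : ((T - μ • 1) ^ (k + 1)) h = 0 := by
    rw [pow_succ', Module.End.mul_apply, LinearMap.mem_ker.1 hh, map_zero]
  refine ⟨fun x : ℝ => Complex.exp (-Complex.I * μ * x) • ∑ j ∈ Finset.range (k + 1),
    ((-Complex.I * x) ^ j / (j.factorial : ℂ)) • ((T - μ • 1) ^ j) h, ?_, fun x => ?_,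
    -μ.im / 2, by linarith, ?_⟩
  · simp [Finset.sum_range_succ']
  · simpa [hh'] using exp_polynomial_hasDerivAt T μ h k x
  · have h1 : (fun x : ℝ => Complex.exp (-Complex.I * μ * x)) =O[atTop]
        fun x : ℝ => Real.exp (μ.im * x) := by
      refine IsBigO.of_bound 1 (Eventually.of_forall fun x => ?_)
      rw [Complex.norm_exp]
      simp
    have h2 : (fun x : ℝ => ∑ j ∈ Finset.range (k + 1),
        ((-Complex.I * x) ^ j / (j.factorial : ℂ)) • ((T - μ • 1) ^ j) h) =O[atTop]
        fun x : ℝ => Real.exp (-μ.im / 2 * x) := by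
      refine IsBigO.fun_sum fun j _ => ?_
      refine IsBigO.trans ?_ (isLittleO_pow_exp_pos_mul_atTop j
        (by linarith : 0 < -μ.im / 2)).isBigO
      refine IsBigO.of_bound ((j.factorial : ℝ)⁻¹ * ‖((T - μ • 1) ^ j) h‖)
        (Eventually.of_forall fun x => le_of_eq ?_)
      rw [norm_smul, norm_div, norm_pow, norm_mul, norm_pow, norm_neg, Complex.norm_I,
        Complex.norm_real, Complex.norm_natCast]
      ring
    refine (h1.smul h2).congr_right fun x => ?_
    rw [smul_eq_mul, ← Real.exp_add]
    congr 1; ring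

lemma lowerSpectralSubspace_le_decayingData (T : Module.End ℂ E) :
    lowerSpectralSubspace T ≤ decayingData T :=
  iSup₂_le fun _ hμ => iSup_le fun k => ker_pow_le_decayingData T hμ k

/-- Energy estimate for `L²` solutions of `u' + iTu = f` on the half line, with a symmetric
multiplier `K` for which `iT` is accretive. -/
lemma energy_estimate (K : E →L[ℂ] E) (hK : (K : E →ₗ[ℂ] E).IsSymmetric) (T : Module.End ℂ E)
    {a B : ℝ} (ha : 0 < a) (hB : ‖K‖ ≤ B)
    (hdiss : ∀ v, a * ‖v‖ ^ 2 ≤ (inner ℂ (K v) (Complex.I • T v)).re)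
    {u f : ℝ → E} (hu : ContinuousOn u (Set.Ici 0))
    (hderiv : ∀ x : ℝ, 0 < x → HasDerivAt u (f x - Complex.I • T (u x)) x)
    (hui : IntegrableOn (fun x => ‖u x‖ ^ 2) (Set.Ioi 0))
    (hfi : IntegrableOn (fun x => ‖f x‖ ^ 2) (Set.Ioi 0)) :
    a * (∫ x in Set.Ioi (0 : ℝ), ‖u x‖ ^ 2) ≤
      (inner ℂ (K (u 0)) (u 0)).re + B ^ 2 / a * ∫ x in Set.Ioi (0 : ℝ), ‖f x‖ ^ 2 := by
  set g : ℝ → ℝ := fun x => (inner ℂ (K (u x)) (u x)).re with hg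
  set φ : ℝ → ℝ := fun x => B ^ 2 / a * ‖f x‖ ^ 2 - a * ‖u x‖ ^ 2 with hφ
  have hB0 : 0 ≤ B := (norm_nonneg K).trans hB
  have hφi : IntegrableOn φ (Set.Ioi 0) := (hfi.const_mul _).sub (hui.const_mul _)
  have hKle : ∀ v, ‖K v‖ ≤ B * ‖v‖ := fun v =>
    (K.le_opNorm v).trans (mul_le_mul_of_nonneg_right hB (norm_nonneg v))
  have hgd : ∀ x, 0 < x → HasDerivAt g
      (2 * (inner ℂ (K (u x)) (f x - Complex.I • T (u x))).re) x := by
    intro x hx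
    have h1 := ((K.restrictScalars ℝ).hasFDerivAt.comp_hasDerivAt x (hderiv x hx)).inner ℂ
      (hderiv x hx)
    refine (Complex.reCLM.hasFDerivAt.comp_hasDerivAt x h1).congr_deriv ?_
    have h2 := hK (f x - Complex.I • T (u x)) (u x)
    simp only [ContinuousLinearMap.coe_coe] at h2
    have h3 : (inner ℂ (f x - Complex.I • T (u x)) (K (u x))).re =
        (inner ℂ (K (u x)) (f x - Complex.I • T (u x))).re :=
      inner_re_symm (𝕜 := ℂ) _ _
    simp only [Function.comp_apply, ContinuousLinearMap.coe_restrictScalars', Complex.reCLM_apply,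
      Complex.add_re, h2, h3]
    ring
  have hgle : ∀ x, 2 * (inner ℂ (K (u x)) (f x - Complex.I • T (u x))).re ≤ φ x := by
    intro x
    have h1 : (inner ℂ (K (u x)) (f x)).re ≤ B * ‖u x‖ * ‖f x‖ :=
      ((Complex.re_le_norm _).trans (norm_inner_le_norm _ _)).trans
        (mul_le_mul_of_nonneg_right (hKle _) (norm_nonneg _))
    have h2 := hdiss (u x)
    have h3 : 2 * (B * ‖u x‖ * ‖f x‖) ≤ B ^ 2 / a * ‖f x‖ ^ 2 + a * ‖u x‖ ^ 2 := by
      have : B ^ 2 / a * ‖f x‖ ^ 2 + a * ‖u x‖ ^ 2 - 2 * (B * ‖u x‖ * ‖f x‖) =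
          (B * ‖f x‖ - a * ‖u x‖) ^ 2 / a := by field_simp; ring
      have : 0 ≤ (B * ‖f x‖ - a * ‖u x‖) ^ 2 / a := by positivity
      linarith
    rw [inner_sub_right, Complex.sub_re]
    simp only [hφ]
    linarith
  have hgc : ContinuousOn g (Set.Ici 0) :=
    Complex.continuous_re.comp_continuousOn ((K.continuous.comp_continuousOn hu).inner hu)
  have hmain : ∀ X, 0 ≤ X → g X - g 0 ≤ ∫ y in (0 : ℝ)..X, φ y := by
    intro X hX
    refine intervalIntegral.sub_le_integral_of_hasDeriv_right_of_le hX
      (hgc.mono Set.Icc_subset_Ici_self) (fun x hx => (hgd x hx.1).hasDerivWithinAt) ?_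
      fun x _ => hgle x
    exact (integrableOn_Ici_iff_integrableOn_Ioi (by finiteness)).2 hφi |>.mono_set
      Set.Icc_subset_Ici_self
  have hlim := intervalIntegral_tendsto_integral_Ioi 0 hφi tendsto_id
  have hfreq : ∀ ε > 0, ∃ᶠ X in atTop, ‖u X‖ ^ 2 < ε := by
    intro ε hε hev
    simp only [not_lt] at hev
    obtain ⟨R, hR⟩ := eventually_atTop.1 hev
    have hc : IntegrableOn (fun _ : ℝ => ε) (Set.Ioi (max R 0)) := by
      refine Integrable.mono' (hui.mono_set (Set.Ioi_subset_Ioi (le_max_right _ _)))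
        aestronglyMeasurable_const ?_
      filter_upwards [ae_restrict_mem measurableSet_Ioi] with x hx
      rw [Real.norm_of_nonneg hε.le]
      exact hR x ((le_max_left _ _).trans (le_of_lt hx))
    rw [integrableOn_const_iff] at hc
    simp [hε.ne'] at hc
  have hfinal : -g 0 ≤ ∫ y in Set.Ioi (0 : ℝ), φ y := by
    refine le_of_forall_pos_le_add fun ε hε => ?_
    have h1 : ∀ᶠ X in atTop, ∫ y in (0 : ℝ)..X, φ y < (∫ y in Set.Ioi (0 : ℝ), φ y) + ε / 2 :=
      hlim.eventually (gt_mem_nhds (by linarith))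
    obtain ⟨X, hX, hX1, hX0⟩ := ((hfreq (ε / (2 * (B + 1))) (by positivity)).and_eventually
      (h1.and (eventually_ge_atTop 0))).exists
    have h2 := hmain X hX0
    have h3 : -(B * ‖u X‖ ^ 2) ≤ g X := by
      have := (Complex.abs_re_le_norm _).trans (norm_inner_le_norm (𝕜 := ℂ) (K (u X)) (u X))
      have h4 := (abs_le.1 this).1
      have h5 := mul_le_mul_of_nonneg_right (hKle (u X)) (norm_nonneg (u X))
      simp only [hg]
      nlinarith
    rw [lt_div_iff₀ (by positivity)] at hX
    nlinarith [sq_nonneg ‖u X‖]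
  have hsplit : ∫ y in Set.Ioi (0 : ℝ), φ y = B ^ 2 / a * (∫ x in Set.Ioi (0 : ℝ), ‖f x‖ ^ 2) -
      a * ∫ x in Set.Ioi (0 : ℝ), ‖u x‖ ^ 2 := by
    rw [integral_sub (hfi.const_mul _) (hui.const_mul _), integral_const_mul, integral_const_mul]
  rw [hsplit] at hfinal
  simp only [hg] at hfinal
  linarith

lemma integrableOn_norm_sq_of_isBigO_exp_neg {F : Type*} [NormedAddCommGroup F] {w : ℝ → F}
    (hw : Continuous w) {b : ℝ} (hb : 0 < b)
    (hwb : w =O[atTop] fun x => Real.exp (-b * x)) :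
    IntegrableOn (fun x => ‖w x‖ ^ 2) (Set.Ioi 0) := by
  refine integrable_of_isBigO_exp_neg (b := b + b) (by linarith) (by fun_prop) ?_
  refine (hwb.norm_left.mul hwb.norm_left).congr (fun x => (sq _).symm) fun x => ?_
  rw [← Real.exp_add]; congr 1; ring

/-- The stable subspace contains no nonzero vector on which the form `⟨K·,·⟩` is negative. -/
lemma eq_zero_of_mem_lowerSpectralSubspace (K : E →L[ℂ] E) (hK : (K : E →ₗ[ℂ] E).IsSymmetric)
    (T : Module.End ℂ E) {a c : ℝ} (ha : 0 < a) (hc : 0 < c)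
    (hdiss : ∀ v, a * ‖v‖ ^ 2 ≤ (inner ℂ (K v) (Complex.I • T v)).re)
    {h : E} (hh : h ∈ lowerSpectralSubspace T) (hneg : (inner ℂ (K h) h).re ≤ -(c * ‖h‖ ^ 2)) :
    h = 0 := by
  obtain ⟨w, rfl, hw, b, hb, hwb⟩ := lowerSpectralSubspace_le_decayingData T hh
  have hwc : Continuous w := continuous_iff_continuousAt.2 fun x => (hw x).continuousAt
  have hen := energy_estimate K hK T (f := fun _ => 0) ha le_rfl hdiss hwc.continuousOn
    (fun x _ => by simpa using hw x) (integrableOn_norm_sq_of_isBigO_exp_neg hwc hb hwb) (by simp)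
  have hnn : 0 ≤ ∫ x in Set.Ioi (0 : ℝ), ‖w x‖ ^ 2 := integral_nonneg fun x => sq_nonneg _
  have hz : c * ‖w 0‖ ^ 2 ≤ 0 := by
    simp only [norm_zero, ne_eq, OfNat.ofNat_ne_zero, not_false_eq_true, zero_pow,
      integral_zero, mul_zero, add_zero] at hen
    nlinarith
  have : ‖w 0‖ ^ 2 ≤ 0 := nonpos_of_mul_nonpos_right hz hc
  simpa using le_antisymm this (sq_nonneg _)

lemma lowerSpectralSubspace_sup_neg [FiniteDimensional ℂ E] (T : Module.End ℂ E)
    (hT : ∀ μ : ℂ, μ.im = 0 → ∀ v, T v = μ • v → v = 0) :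
    lowerSpectralSubspace T ⊔ lowerSpectralSubspace (-T) = ⊤ := by
  rw [eq_top_iff, ← Module.End.iSup_maxGenEigenspace_eq_top T]
  refine iSup_le fun μ x hx => ?_
  obtain ⟨k, hk⟩ := (Module.End.mem_maxGenEigenspace T μ x).1 hx
  rcases lt_trichotomy μ.im 0 with hμ | hμ | hμ
  · refine Submodule.mem_sup_left ?_
    exact Submodule.mem_iSup_of_mem μ (Submodule.mem_iSup_of_mem hμ
      (Submodule.mem_iSup_of_mem k hk))
  · have hinj : Function.Injective (T - μ • (1 : Module.End ℂ E)) := by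
      refine (injective_iff_map_eq_zero _).2 fun v hv => hT μ hμ v ?_
      simpa [sub_eq_zero] using hv
    have hx0 : x = 0 := by
      have := hinj.iterate k
      rw [← Module.End.coe_pow] at this
      exact this (by rw [hk, map_zero])
    rw [hx0]; exact zero_mem _
  · refine Submodule.mem_sup_right ?_
    have hμ' : -μ ∈ {μ : ℂ | μ.im < 0} := by simpa using hμ
    refine Submodule.mem_iSup_of_mem (-μ) (Submodule.mem_iSup_of_mem hμ'
      (Submodule.mem_iSup_of_mem k ?_))
    have : (-T - -μ • (1 : Module.End ℂ E)) = -(T - μ • 1) := by module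
    rw [LinearMap.mem_ker, this, neg_pow, Module.End.mul_apply, hk, map_zero]

/-- A maximal negative subspace of `K` and the stable subspace span the whole space. -/
lemma lowerSpectralSubspace_sup_eq_top [FiniteDimensional ℂ E] (K : E →L[ℂ] E)
    (hK : (K : E →ₗ[ℂ] E).IsSymmetric) (T : Module.End ℂ E) {a c : ℝ} (ha : 0 < a) (hc : 0 < c)
    (hdiss : ∀ v, a * ‖v‖ ^ 2 ≤ (inner ℂ (K v) (Complex.I • T v)).re) {W P : Submodule ℂ E}
    (hW : ∀ n ∈ W, (inner ℂ (K n) n).re ≤ -(c * ‖n‖ ^ 2))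
    (hP : ∀ n ∈ P, c * ‖n‖ ^ 2 ≤ (inner ℂ (K n) n).re) (hWP : W ⊔ P = ⊤) :
    lowerSpectralSubspace T ⊔ W = ⊤ := by
  have h1 : lowerSpectralSubspace T ⊓ W = ⊥ := (Submodule.eq_bot_iff _).2 fun x hx =>
    eq_zero_of_mem_lowerSpectralSubspace K hK T ha hc hdiss hx.1 (hW x hx.2)
  have h2 : lowerSpectralSubspace (-T) ⊓ P = ⊥ := (Submodule.eq_bot_iff _).2 fun x hx =>
    eq_zero_of_mem_lowerSpectralSubspace (-K)
      (fun x y => by simpa using hK x y) (-T) ha hc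
      (fun v => by simpa using hdiss v) hx.1 (by simpa using hP x hx.2)
  have h3 : lowerSpectralSubspace T ⊔ lowerSpectralSubspace (-T) = ⊤ := by
    refine lowerSpectralSubspace_sup_neg T fun μ hμ v hv => ?_
    have h4 := hdiss v
    have h5 : (inner ℂ (K v) v).im = 0 := by
      have := hK.im_inner_apply_self v
      simpa using this
    have h6 : ‖v‖ ^ 2 ≤ 0 := by
      rw [hv, inner_smul_right, inner_smul_right] at h4
      simp only [Complex.mul_re, Complex.I_re, Complex.I_im, Complex.mul_im, hμ, h5] at h4
      exact nonpos_of_mul_nonpos_right (by linarith) ha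
    simpa using le_antisymm h6 (sq_nonneg _)
  apply Submodule.eq_top_of_finrank_eq
  have e1 := Submodule.finrank_sup_add_finrank_inf_eq (lowerSpectralSubspace T) W
  have e2 := Submodule.finrank_sup_add_finrank_inf_eq (lowerSpectralSubspace (-T)) P
  have e3 := Submodule.finrank_add_le_finrank_add_finrank (lowerSpectralSubspace T)
    (lowerSpectralSubspace (-T))
  have e4 := Submodule.finrank_add_le_finrank_add_finrank W P
  have e5 := Submodule.finrank_le (lowerSpectralSubspace T ⊔ W)
  have e6 := Submodule.finrank_le (lowerSpectralSubspace (-T) ⊔ P)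
  rw [h1, finrank_bot] at e1
  rw [h2, finrank_bot] at e2
  rw [h3, finrank_top] at e3
  rw [hWP, finrank_top] at e4
  omega

/-- Trace estimate for `u' + iTu = f` when the boundary operator `M` controls the stable
subspace of `T`. -/
lemma trace_estimate [FiniteDimensional ℂ E] {F : Type*} [SeminormedAddCommGroup F] [Module ℂ F]
    (K : E →L[ℂ] E)
    (hK : (K : E →ₗ[ℂ] E).IsSymmetric) (T : Module.End ℂ E) {a c B C m : ℝ} (ha : 0 < a)
    (hc : 0 < c) (hC : 0 ≤ C) (hm : 0 ≤ m) (hB : ‖K‖ ≤ B)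
    (hdiss : ∀ v, a * ‖v‖ ^ 2 ≤ (inner ℂ (K v) (Complex.I • T v)).re) {W P : Submodule ℂ E}
    (hW : ∀ n ∈ W, (inner ℂ (K n) n).re ≤ -(c * ‖n‖ ^ 2))
    (hP : ∀ n ∈ P, c * ‖n‖ ^ 2 ≤ (inner ℂ (K n) n).re) (hWP : W ⊔ P = ⊤)
    (M : E →ₗ[ℂ] F) (hM : ∀ v, ‖M v‖ ≤ m * ‖v‖)
    (hLop : ∀ h ∈ lowerSpectralSubspace T, ‖h‖ ≤ C * ‖M h‖)
    {u f : ℝ → E} (hu : ContinuousOn u (Set.Ici 0))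
    (hderiv : ∀ x : ℝ, 0 < x → HasDerivAt u (f x - Complex.I • T (u x)) x)
    (hui : IntegrableOn (fun x => ‖u x‖ ^ 2) (Set.Ioi 0))
    (hfi : IntegrableOn (fun x => ‖f x‖ ^ 2) (Set.Ioi 0)) :
    ‖u 0‖ ^ 2 ≤ 2 * C ^ 2 * ‖M (u 0)‖ ^ 2 +
      2 * (C * m + 1) ^ 2 * (B ^ 2 / (a * c) * ∫ x in Set.Ioi (0 : ℝ), ‖f x‖ ^ 2) := by
  have htop := lowerSpectralSubspace_sup_eq_top K hK T ha hc hdiss hW hP hWP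
  obtain ⟨h, hh, n, hn, hsum⟩ := Submodule.mem_sup.1 (htop ▸ Submodule.mem_top : u 0 ∈ _)
  obtain ⟨w, hw0, hw, b, hb, hwb⟩ := lowerSpectralSubspace_le_decayingData T hh
  have hwc : Continuous w := continuous_iff_continuousAt.2 fun x => (hw x).continuousAt
  have hwi := integrableOn_norm_sq_of_isBigO_exp_neg hwc hb hwb
  have hvi : IntegrableOn (fun x => ‖u x - w x‖ ^ 2) (Set.Ioi 0) := by
    refine Integrable.mono' ((hui.const_mul 2).add (hwi.const_mul 2)) ?_
      (Eventually.of_forall fun x => ?_)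
    · exact (((hu.mono Set.Ioi_subset_Ici_self).sub hwc.continuousOn).norm.pow 2
        ).aestronglyMeasurable measurableSet_Ioi
    · rw [Real.norm_of_nonneg (sq_nonneg _)]
      have := norm_sub_le (u x) (w x)
      have h0 := norm_nonneg (u x - w x)
      simp only [Pi.add_apply]
      nlinarith [sq_nonneg (‖u x‖ - ‖w x‖)]
  have hen := energy_estimate K hK T (u := fun x => u x - w x) ha hB hdiss
    (hu.sub hwc.continuousOn) (fun x hx => ((hderiv x hx).sub (hw x)).congr_deriv (by
      rw [map_sub]; module)) hvi hfi
  have hv0 : u 0 - w 0 = n := by rw [hw0, ← hsum]; abel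
  simp only [hv0] at hen
  have hnn : 0 ≤ a * ∫ x in Set.Ioi (0 : ℝ), ‖u x - w x‖ ^ 2 :=
    mul_nonneg ha.le (integral_nonneg fun x => sq_nonneg _)
  have hn2 : ‖n‖ ^ 2 ≤ B ^ 2 / (a * c) * ∫ x in Set.Ioi (0 : ℝ), ‖f x‖ ^ 2 := by
    have h1 : c * ‖n‖ ^ 2 ≤ B ^ 2 / a * ∫ x in Set.Ioi (0 : ℝ), ‖f x‖ ^ 2 := by
      linarith [hW n hn]
    have h2 : B ^ 2 / (a * c) * ∫ x in Set.Ioi (0 : ℝ), ‖f x‖ ^ 2 =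
        (B ^ 2 / a * ∫ x in Set.Ioi (0 : ℝ), ‖f x‖ ^ 2) / c := by field_simp
    rw [h2, le_div_iff₀ hc]; linarith
  have hu0 : ‖u 0‖ ≤ C * ‖M (u 0)‖ + (C * m + 1) * ‖n‖ := by
    have h1 : h = u 0 - n := by rw [← hsum]; abel
    have h2 : ‖u 0‖ ≤ ‖h‖ + ‖n‖ := hsum ▸ norm_add_le h n
    have h3 : ‖M h‖ ≤ ‖M (u 0)‖ + m * ‖n‖ := by
      rw [h1, map_sub]
      exact (norm_sub_le _ _).trans (add_le_add_right (hM n) _)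
    have h4 := mul_le_mul_of_nonneg_left h3 hC
    linarith [hLop h hh]
  calc ‖u 0‖ ^ 2 ≤ (C * ‖M (u 0)‖ + (C * m + 1) * ‖n‖) ^ 2 :=
        pow_le_pow_left₀ (norm_nonneg _) hu0 2
    _ ≤ 2 * C ^ 2 * ‖M (u 0)‖ ^ 2 + 2 * (C * m + 1) ^ 2 * ‖n‖ ^ 2 := by
        nlinarith [sq_nonneg (C * ‖M (u 0)‖ - (C * m + 1) * ‖n‖)]
    _ ≤ _ := by gcongr

/-- An injective symmetric operator is uniformly definite on two subspaces spanning the space. -/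
lemma LinearMap.IsSymmetric.exists_definite_subspaces [FiniteDimensional ℂ E] {T : E →ₗ[ℂ] E}
    (hT : T.IsSymmetric) (hinj : ∀ v, T v = 0 → v = 0) :
    ∃ W P : Submodule ℂ E, ∃ c > (0 : ℝ), (∀ n ∈ W, (inner ℂ (T n) n).re ≤ -(c * ‖n‖ ^ 2)) ∧
      (∀ n ∈ P, c * ‖n‖ ^ 2 ≤ (inner ℂ (T n) n).re) ∧ W ⊔ P = ⊤ := by
  obtain ⟨b, ev, hbe⟩ : ∃ (b : OrthonormalBasis (Fin (Module.finrank ℂ E)) ℂ E)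
      (ev : Fin (Module.finrank ℂ E) → ℝ), ∀ i, T (b i) = (ev i : ℂ) • b i :=
    ⟨hT.eigenvectorBasis rfl, hT.eigenvalues rfl, hT.apply_eigenvectorBasis rfl⟩
  have hne : ∀ i, ev i ≠ 0 := by
    intro i hi
    have h1 := hinj (b i) (by rw [hbe, hi]; simp)
    exact b.orthonormal.ne_zero i h1
  have hform : ∀ n, (inner ℂ (T n) n).re = ∑ i, ev i * ‖inner ℂ (b i) n‖ ^ 2 := by
    intro n
    rw [← b.sum_inner_mul_inner, Complex.re_sum]
    refine Finset.sum_congr rfl fun i _ => ?_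
    rw [hT, hbe, inner_smul_right, mul_assoc, ← inner_conj_symm n (b i), Complex.re_ofReal_mul,
      ← Complex.normSq_eq_conj_mul_self, Complex.ofReal_re, Complex.normSq_eq_norm_sq]
  have hnorm : ∀ n, ‖n‖ ^ 2 = ∑ i, ‖inner ℂ (b i) n‖ ^ 2 := fun n =>
    (b.sum_sq_norm_inner_right n).symm
  obtain ⟨c, hc, hcle⟩ : ∃ c > (0 : ℝ), ∀ i, c ≤ |ev i| := by
    rcases isEmpty_or_nonempty (Fin (Module.finrank ℂ E)) with he | he
    · exact ⟨1, one_pos, fun i => he.elim i⟩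
    · obtain ⟨i, hi⟩ := Finite.exists_min fun i => |ev i|
      exact ⟨_, abs_pos.2 (hne i), hi⟩
  let V : (ℝ → Prop) → Submodule ℂ E := fun p =>
    ⨅ i ∈ {i | p (ev i)}, LinearMap.ker (innerₛₗ ℂ (b i))
  have hV : ∀ p n, n ∈ V p ↔ ∀ i, p (ev i) → inner ℂ (b i) n = 0 := fun p n => by
    simp [V]
  refine ⟨V fun t => 0 < t, V fun t => t < 0, c, hc, fun n hn => ?_, fun n hn => ?_, ?_⟩
  · rw [hform, hnorm, Finset.mul_sum, ← Finset.sum_neg_distrib]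
    refine Finset.sum_le_sum fun i _ => ?_
    rcases (hne i).lt_or_gt with hi | hi
    · have := hcle i
      rw [abs_of_neg hi] at this
      nlinarith [sq_nonneg ‖inner ℂ (b i) n‖]
    · simp [(hV (fun t => 0 < t) n).1 hn i hi]
  · rw [hform, hnorm, Finset.mul_sum]
    refine Finset.sum_le_sum fun i _ => ?_
    rcases (hne i).lt_or_gt with hi | hi
    · simp [(hV (fun t => t < 0) n).1 hn i hi]
    · have := hcle i
      rw [abs_of_pos hi] at this
      nlinarith [sq_nonneg ‖inner ℂ (b i) n‖]
  · refine eq_top_iff.2 fun x _ => ?_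
    rw [← b.sum_repr x]
    refine Submodule.sum_mem _ fun i _ => Submodule.smul_mem _ _ ?_
    have horth : ∀ j, ev j ≠ ev i → inner ℂ (b j) (b i) = 0 := fun j hj =>
      b.orthonormal.2 fun h => hj (by rw [h])
    rcases (hne i).lt_or_gt with hi | hi
    · exact Submodule.mem_sup_left
        ((hV (fun t => 0 < t) _).2 fun j hj => horth j (hi.trans hj).ne')
    · exact Submodule.mem_sup_right
        ((hV (fun t => t < 0) _).2 fun j hj => horth j (lt_trans hj hi).ne)

/-- The quadratic form of a continuous family of operators depends continuously on the parameter,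
uniformly on the unit sphere. -/
lemma eventually_le_re_inner {X : Type*} [TopologicalSpace X] {K : X → E →L[ℂ] E} {x₀ : X}
    (hK : ContinuousAt K x₀) {c : ℝ} (hc : 0 < c) :
    ∀ᶠ x in 𝓝 x₀, ∀ v, |(inner ℂ (K x v) v).re - (inner ℂ (K x₀ v) v).re| ≤ c * ‖v‖ ^ 2 := by
  filter_upwards [Metric.continuousAt_iff'.1 hK c hc] with x hx v
  rw [dist_eq_norm] at hx
  rw [← Complex.sub_re, ← inner_sub_left, ← sub_apply]
  calc _ ≤ ‖(K x - K x₀) v‖ * ‖v‖ := (Complex.abs_re_le_norm _).trans (norm_inner_le_norm _ _)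
    _ ≤ c * ‖v‖ * ‖v‖ := by
        gcongr
        exact (ContinuousLinearMap.le_opNorm _ _).trans (by gcongr)
    _ = _ := by ring

lemma Matrix.IsHermitian.im_inner_toEuclideanLin {n : Type*} [Fintype n] [DecidableEq n]
    {Q : Matrix n n ℂ} (hQ : Q.IsHermitian) (v : EuclideanSpace ℂ n) :
    (inner ℂ v (Matrix.toEuclideanLin Q v)).im = 0 := by
  simpa using (Matrix.isSymmetric_toEuclideanLin_iff.2 hQ).im_inner_self_apply v

lemma Matrix.PosDef.exists_coercive {n : Type*} [Fintype n] [DecidableEq n]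
    {Q : Matrix n n ℂ} (hQ : Q.PosDef) :
    ∃ c > (0 : ℝ), ∀ v : EuclideanSpace ℂ n,
      c * ‖v‖ ^ 2 ≤ (inner ℂ (Matrix.toEuclideanLin Q v) v).re := by
  have hsym := Matrix.isSymmetric_toEuclideanLin_iff.2 hQ.1
  have hpos : ∀ v : EuclideanSpace ℂ n, v ≠ 0 →
      0 < (inner ℂ (Matrix.toEuclideanLin Q v) v).re := by
    intro v hv
    have h1 := hQ.dotProduct_mulVec_pos (x := v.ofLp) (by simpa using hv)
    rw [hsym v v, EuclideanSpace.inner_eq_star_dotProduct, dotProduct_comm]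
    exact (Complex.lt_def.1 h1).1
  obtain ⟨W, P, c, hc, hW, hP, hWP⟩ := hsym.exists_definite_subspaces (fun v hv => by
    by_contra h
    simpa [hv] using hpos v h)
  refine ⟨c, hc, fun v => hP v ?_⟩
  have hbot : W = ⊥ := (Submodule.eq_bot_iff _).2 fun n hn => by
    by_contra h
    have := hW n hn
    have := hpos n h
    nlinarith [sq_nonneg ‖n‖]
  rw [hbot, bot_sup_eq] at hWP
  rw [hWP]; trivial

lemma re_inner_bdrySymbol {P N d : ℕ} {A : Fin d → (Fin P → ℝ) → Matrix (Fin N) (Fin N) ℂ}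
    {Ad S : (Fin P → ℝ) → Matrix (Fin N) (Fin N) ℂ} {p : Fin P → ℝ} (hAd : IsUnit (Ad p).det)
    (hS : (S p).IsHermitian) (hSA : ∀ j, (S p * A j p).IsHermitian)
    (hSAd : (S p * Ad p).IsHermitian) (ζ : ℝ × (Fin d → ℝ) × ℝ) (v : EuclideanSpace ℂ (Fin N)) :
    (inner ℂ (Matrix.toEuclideanLin (S p * Ad p) v)
      (Complex.I • Matrix.toEuclideanLin (bdrySymbol A Ad p ζ) v)).re =
      ζ.2.2 * (inner ℂ (Matrix.toEuclideanLin (S p) v) v).re := by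
  have hprod : S p * Ad p * bdrySymbol A Ad p ζ =
      ((ζ.1 : ℂ) - Complex.I * (ζ.2.2 : ℂ)) • S p + ∑ j, (ζ.2.1 j : ℂ) • (S p * A j p) := by
    rw [bdrySymbol, mul_assoc, Matrix.mul_nonsing_inv_cancel_left _ _ hAd, mul_add,
      Matrix.mul_smul, mul_one, Finset.mul_sum]
    simp only [Matrix.mul_smul]
  have hcomp : ∀ w, Matrix.toEuclideanLin (S p * Ad p) (Matrix.toEuclideanLin w v) =
      Matrix.toEuclideanLin (S p * Ad p * w) v := fun w => by
    simp [Matrix.toLpLin_apply, Matrix.mulVec_mulVec]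
  have hre : (inner ℂ (Matrix.toEuclideanLin (S p) v) v).re =
      (inner ℂ v (Matrix.toEuclideanLin (S p) v)).re :=
    inner_re_symm (𝕜 := ℂ) _ _
  rw [(Matrix.isSymmetric_toEuclideanLin_iff.2 hSAd) v, map_smul, inner_smul_right, hcomp, hprod,
    map_add, map_sum, LinearMap.add_apply, LinearMap.sum_apply, inner_add_right, inner_sum]
  simp only [map_smul, LinearMap.smul_apply, inner_smul_right, hre]
  have hz := hS.im_inner_toEuclideanLin v
  have hsum : (∑ j, (ζ.2.1 j : ℂ) * inner ℂ v (Matrix.toEuclideanLin (S p * A j p) v)).im = 0 := by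
    rw [Complex.im_sum]
    exact Finset.sum_eq_zero fun j _ => by
      rw [Complex.im_ofReal_mul, (hSA j).im_inner_toEuclideanLin v, mul_zero]
  generalize (∑ j, (ζ.2.1 j : ℂ) * inner ℂ v (Matrix.toEuclideanLin (S p * A j p) v)) = y at hsum ⊢
  simp [Complex.mul_re, Complex.mul_im, hz, hsum]

lemma continuous_toContinuousLinearMap_toEuclideanLin {m n : Type*} [Fintype m] [Fintype n]
    [DecidableEq n] : Continuous fun Q : Matrix m n ℂ =>
      LinearMap.toContinuousLinearMap (Matrix.toEuclideanLin Q) :=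
  LinearMap.continuous_of_finiteDimensional
    (Matrix.toEuclideanLin ≪≫ₗ LinearMap.toContinuousLinearMap :
      Matrix m n ℂ ≃ₗ[ℂ] (EuclideanSpace ℂ n →L[ℂ] EuclideanSpace ℂ m)).toLinearMap

lemma exists_toEuclideanLin_bound {X m n : Type*} [TopologicalSpace X] [Fintype m] [Fintype n]
    [DecidableEq n] {M : X → Matrix m n ℂ} {s : Set X} (hs : IsCompact s)
    (hM : ∀ i k, ContinuousOn (fun x => M x i k) s) :
    ∃ c : ℝ, 0 ≤ c ∧ ∀ x ∈ s, ∀ v, ‖Matrix.toEuclideanLin (M x) v‖ ≤ c * ‖v‖ := by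
  have hMc : ContinuousOn M s := continuousOn_pi.2 fun i => continuousOn_pi.2 fun k => hM i k
  obtain ⟨c, hc⟩ := hs.exists_bound_of_continuousOn
    (continuous_toContinuousLinearMap_toEuclideanLin.comp_continuousOn hMc)
  refine ⟨max c 0, le_max_right _ _, fun x hx v => ?_⟩
  exact ((LinearMap.toContinuousLinearMap (Matrix.toEuclideanLin (M x))).le_opNorm v).trans
    (mul_le_mul_of_nonneg_right ((hc x hx).trans (le_max_left _ _)) (norm_nonneg _))

lemma isCompact_setOf_sq_sum_eq_one (d : ℕ) :
    IsCompact {ζ : ℝ × (Fin d → ℝ) × ℝ | ζ.1 ^ 2 + (∑ j, ζ.2.1 j ^ 2) + ζ.2.2 ^ 2 = 1} := by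
  refine Metric.isCompact_of_isClosed_isBounded (isClosed_eq (by fun_prop) continuous_const) ?_
  refine (Metric.isBounded_closedBall (x := 0) (r := 1)).subset fun ζ hζ => ?_
  have hζ' : ζ.1 ^ 2 + (∑ j, ζ.2.1 j ^ 2) + ζ.2.2 ^ 2 = 1 := hζ
  have h0 : 0 ≤ ∑ j, ζ.2.1 j ^ 2 := Finset.sum_nonneg fun j _ => sq_nonneg _
  rw [mem_closedBall_zero_iff, norm_prod_le_iff, norm_prod_le_iff,
    pi_norm_le_iff_of_nonneg zero_le_one]
  refine ⟨abs_le_one_iff_mul_self_le_one.2 ?_, fun j => abs_le_one_iff_mul_self_le_one.2 ?_,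
    abs_le_one_iff_mul_self_le_one.2 ?_⟩
  · nlinarith [sq_nonneg ζ.2.2]
  · have := Finset.single_le_sum (f := fun j => ζ.2.1 j ^ 2) (fun j _ => sq_nonneg _)
      (Finset.mem_univ j)
    nlinarith [sq_nonneg ζ.2.2, sq_nonneg ζ.1]
  · nlinarith [sq_nonneg ζ.1]

end Helpers

/-- **First Main Theorem (Theorem 4.2): maximal estimates under the uniform Lopatinski
condition.**  Let `A₁,…,A_{d−1}` (the family `A`) and `A_d = Ad` be smooth with `Ad(p)`
invertible, Friedrichs-symmetrizable via a smooth Hermitian positive definite `S(p)` making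
all `S A_j` and `S A_d` Hermitian.  Fix `p̄` and assume every real characteristic root at
`p̄`, of multiplicity `m`, is either geometrically regular or totally nonglancing.  Let
`M(p,ζ)` be smooth for `ζ ≠ 0`, homogeneous of degree `0` in `ζ`, and satisfy the uniform
Lopatinski condition near `p̄`.  Then the maximal estimate holds: there exist a neighborhood
of `p̄` and `K > 0` such that for `p` in this neighborhood, `ζ = (τ,η,γ)` with `γ > 0` and
`|ζ| = 1`, any `f ∈ L²`, and any continuously differentiable `u ∈ L²` on `[0,∞)` with
`u′ + iG(p,ζ)u = f`, one has
`γ‖u‖²_{L²} + |u(0)|² ≤ K(γ⁻¹‖f‖²_{L²} + |M(p,ζ)u(0)|²)`. -/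
theorem maximal_estimate_of_uniform_lopatinski {P N d : ℕ}
    (A : Fin d → (Fin P → ℝ) → Matrix (Fin N) (Fin N) ℂ)
    (Ad : (Fin P → ℝ) → Matrix (Fin N) (Fin N) ℂ)
    (hA : ∀ j i k, ContDiff ℝ (⊤ : ℕ∞) (fun p => A j p i k))
    (hAd : ∀ i k, ContDiff ℝ (⊤ : ℕ∞) (fun p => Ad p i k))
    (hAdinv : ∀ p, IsUnit (Ad p).det)
    (S : (Fin P → ℝ) → Matrix (Fin N) (Fin N) ℂ)
    (hSsmooth : ∀ i k, ContDiff ℝ (⊤ : ℕ∞) (fun p => S p i k))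
    (hSpd : ∀ p, (S p).PosDef)
    (hSA : ∀ p j, (S p * A j p).IsHermitian)
    (hSAd : ∀ p, (S p * Ad p).IsHermitian)
    (p0 : Fin P → ℝ)
    (hchar : ∀ (tb : ℝ) (ω0 : (Fin d → ℝ) × ℝ), ω0 ≠ 0 →
      charDet A Ad p0 tb ω0 = 0 →
      GeomRegular A Ad p0 tb ω0 (multAt (fun j => A j p0) (Ad p0) tb ω0.1 ω0.2) ∨
      TotallyNonglancing A Ad p0 tb ω0)
    {q : ℕ} (M : (Fin P → ℝ) → (ℝ × (Fin d → ℝ) × ℝ) → Matrix (Fin q) (Fin N) ℂ)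
    (hM : ∀ i k, ContDiffOn ℝ (⊤ : ℕ∞)
      (fun x : (Fin P → ℝ) × (ℝ × (Fin d → ℝ) × ℝ) => M x.1 x.2 i k)
      {x : (Fin P → ℝ) × (ℝ × (Fin d → ℝ) × ℝ) | x.2 ≠ 0})
    (hMhom : ∀ p ζ (c : ℝ), 0 < c → M p (c • ζ) = M p ζ)
    (hLop : ∃ U ∈ nhds p0, ∃ C > (0:ℝ), ∀ p ∈ U, ∀ ζ : ℝ × (Fin d → ℝ) × ℝ, 0 < ζ.2.2 →
      ∀ h ∈ stableSubspace (bdrySymbol A Ad p ζ),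
        ‖h‖ ≤ C * ‖(Matrix.toEuclideanLin (M p ζ)) h‖) :
    ∃ U ∈ nhds p0, ∃ K > (0:ℝ), ∀ p ∈ U, ∀ ζ : ℝ × (Fin d → ℝ) × ℝ, 0 < ζ.2.2 →
      ζ.1 ^ 2 + (∑ j, ζ.2.1 j ^ 2) + ζ.2.2 ^ 2 = 1 →
      ∀ f u : ℝ → EuclideanSpace ℂ (Fin N),
        ContinuousOn u (Set.Ici 0) →
        (∀ x : ℝ, 0 < x → HasDerivAt u
          (f x - Complex.I • (Matrix.toEuclideanLin (bdrySymbol A Ad p ζ)) (u x)) x) →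
        IntegrableOn (fun x => ‖u x‖ ^ 2) (Set.Ioi 0) →
        IntegrableOn (fun x => ‖f x‖ ^ 2) (Set.Ioi 0) →
        ζ.2.2 * (∫ x in Set.Ioi (0:ℝ), ‖u x‖ ^ 2) + ‖u 0‖ ^ 2 ≤
          K * ((ζ.2.2)⁻¹ * (∫ x in Set.Ioi (0:ℝ), ‖f x‖ ^ 2)
            + ‖(Matrix.toEuclideanLin (M p ζ)) (u 0)‖ ^ 2) := by
  obtain ⟨U₀, hU₀, C, hC, hLop⟩ := hLop
  have hScont : Continuous S := continuous_matrix fun i k => (hSsmooth i k).continuous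
  have hAdcont : Continuous Ad := continuous_matrix fun i k => (hAd i k).continuous
  obtain ⟨σ, hσ, hσle⟩ := (hSpd p0).exists_coercive
  have hKsym : ∀ p, (Matrix.toEuclideanLin (S p * Ad p)).IsSymmetric := fun p =>
    Matrix.isSymmetric_toEuclideanLin_iff.2 (hSAd p)
  have hunit : IsUnit (S p0 * Ad p0) :=
    (hSpd p0).isUnit.mul ((Matrix.isUnit_iff_isUnit_det _).2 (hAdinv p0))
  obtain ⟨W, R, c, hc, hW, hR, hWR⟩ := (hKsym p0).exists_definite_subspaces fun v hv => by
    have h1 : (S p0 * Ad p0).mulVec v.ofLp = 0 := by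
      simpa [-Matrix.toLpLin_mul_same, Matrix.toLpLin_apply] using hv
    have h2 := Matrix.mulVec_injective_of_isUnit hunit (h1.trans (Matrix.mulVec_zero _).symm)
    simpa using h2
  set Kc : (Fin P → ℝ) → EuclideanSpace ℂ (Fin N) →L[ℂ] EuclideanSpace ℂ (Fin N) := fun p =>
    LinearMap.toContinuousLinearMap (Matrix.toEuclideanLin (S p * Ad p)) with hKc
  have hKcont : Continuous Kc :=
    continuous_toContinuousLinearMap_toEuclideanLin.comp (hScont.matrix_mul hAdcont)
  have hSc : Continuous fun p => LinearMap.toContinuousLinearMap (Matrix.toEuclideanLin (S p)) :=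
    continuous_toContinuousLinearMap_toEuclideanLin.comp hScont
  obtain ⟨m, hm, hMle⟩ := exists_toEuclideanLin_bound
    (M := fun x : (Fin P → ℝ) × (ℝ × (Fin d → ℝ) × ℝ) => M x.1 x.2)
    ((isCompact_closedBall p0 1).prod (isCompact_setOf_sq_sum_eq_one d))
    (fun i k => (hM i k).continuousOn.mono (by
      rintro ⟨p, ζ⟩ ⟨-, hζ⟩ h0
      have h0' : ζ = 0 := h0
      simp [h0'] at hζ))
  set B : ℝ := ‖Kc p0‖ + 1 with hB
  have hB0 : 0 < B := by positivity
  have hev : ∀ᶠ p in nhds p0, p ∈ U₀ ∧ p ∈ Metric.closedBall p0 1 ∧ ‖Kc p‖ < B ∧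
      (∀ v, |(inner ℂ (Kc p v) v).re - (inner ℂ (Kc p0 v) v).re| ≤ c / 2 * ‖v‖ ^ 2) ∧
      (∀ v, |(inner ℂ (Matrix.toEuclideanLin (S p) v) v).re -
        (inner ℂ (Matrix.toEuclideanLin (S p0) v) v).re| ≤ σ / 2 * ‖v‖ ^ 2) :=
    (Filter.eventually_mem_set.2 hU₀).and <| (Filter.eventually_mem_set.2 (Metric.closedBall_mem_nhds p0 one_pos)).and <|
      (hKcont.norm.continuousAt.eventually_lt continuousAt_const (by simp [hB])).and <|
      (eventually_le_re_inner hKcont.continuousAt (half_pos hc)).and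
      (eventually_le_re_inner hSc.continuousAt (half_pos hσ))
  set D : ℝ := 2 * (C * m + 1) ^ 2 * (B ^ 2 / (σ / 2 * (c / 2))) with hD
  have hD0 : 0 ≤ D := by positivity
  refine ⟨_, hev, (B / (σ / 2) + 1) * (2 * C ^ 2 + D) + B ^ 2 / (σ / 2) ^ 2, by positivity, ?_⟩
  rintro p ⟨hpU, hpball, hpB, hpK, hpS⟩ ζ hγ hζ f u hu hderiv hui hfi
  have ha : 0 < ζ.2.2 * (σ / 2) := by positivity
  have hdiss : ∀ v, ζ.2.2 * (σ / 2) * ‖v‖ ^ 2 ≤ (inner ℂ (Kc p v)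
      (Complex.I • Matrix.toEuclideanLin (bdrySymbol A Ad p ζ) v)).re := by
    intro v
    refine le_trans ?_ (re_inner_bdrySymbol (hAdinv p) (hSpd p).1 (hSA p) (hSAd p) ζ v).ge
    rw [mul_assoc]
    refine mul_le_mul_of_nonneg_left ?_ hγ.le
    linarith [(abs_le.1 (hpS v)).1, hσle v]
  have hWp : ∀ n ∈ W, (inner ℂ (Kc p n) n).re ≤ -(c / 2 * ‖n‖ ^ 2) := fun n hn => by
    have : (inner ℂ (Kc p0 n) n).re ≤ -(c * ‖n‖ ^ 2) := hW n hn
    linarith [(abs_le.1 (hpK n)).2]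
  have hRp : ∀ n ∈ R, c / 2 * ‖n‖ ^ 2 ≤ (inner ℂ (Kc p n) n).re := fun n hn => by
    have : c * ‖n‖ ^ 2 ≤ (inner ℂ (Kc p0 n) n).re := hR n hn
    linarith [(abs_le.1 (hpK n)).1]
  have htrace := trace_estimate (Kc p) (hKsym p) _ ha (half_pos hc) hC.le hm hpB.le hdiss hWp hRp
    hWR (Matrix.toEuclideanLin (M p ζ)) (hMle (p, ζ) ⟨hpball, hζ⟩) (hLop p hpU ζ hγ) hu hderiv
    hui hfi
  have henergy := energy_estimate (Kc p) (hKsym p) _ ha hpB.le hdiss hu hderiv hui hfi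
  have hbd : (inner ℂ (Kc p (u 0)) (u 0)).re ≤ B * ‖u 0‖ ^ 2 := by
    refine ((Complex.re_le_norm _).trans (norm_inner_le_norm _ _)).trans ?_
    have := (Kc p).le_opNorm (u 0)
    nlinarith [norm_nonneg (u 0), mul_le_mul_of_nonneg_right hpB.le (norm_nonneg (u 0))]
  have hF : 0 ≤ ∫ x in Set.Ioi (0 : ℝ), ‖f x‖ ^ 2 := integral_nonneg fun x => sq_nonneg _
  have hm₀ : 0 ≤ ‖Matrix.toEuclideanLin (M p ζ) (u 0)‖ ^ 2 := sq_nonneg _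
  generalize (∫ x in Set.Ioi (0 : ℝ), ‖f x‖ ^ 2) = F at *
  generalize (∫ x in Set.Ioi (0 : ℝ), ‖u x‖ ^ 2) = V at *
  generalize ‖Matrix.toEuclideanLin (M p ζ) (u 0)‖ ^ 2 = m₀ at *
  generalize ‖u 0‖ ^ 2 = r at *
  have hr : r ≤ 2 * C ^ 2 * m₀ + D * (ζ.2.2⁻¹ * F) := by
    refine htrace.trans_eq ?_
    rw [hD]
    field_simp
  have hV : ζ.2.2 * V ≤ B / (σ / 2) * r + B ^ 2 / (σ / 2) ^ 2 * (ζ.2.2⁻¹ * F) := by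
    have h1 : ζ.2.2 * (σ / 2) * V ≤ B * r + B ^ 2 / (ζ.2.2 * (σ / 2)) * F :=
      henergy.trans (by linarith)
    have h2 : B / (σ / 2) * r + B ^ 2 / (σ / 2) ^ 2 * (ζ.2.2⁻¹ * F) =
        (B * r + B ^ 2 / (ζ.2.2 * (σ / 2)) * F) / (σ / 2) := by
      field_simp
    rw [h2, le_div_iff₀ (half_pos hσ)]
    linarith
  have hγF : 0 ≤ ζ.2.2⁻¹ * F := by positivity
  calc ζ.2.2 * V + r ≤ (B / (σ / 2) + 1) * r + B ^ 2 / (σ / 2) ^ 2 * (ζ.2.2⁻¹ * F) := by linarith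
    _ ≤ (B / (σ / 2) + 1) * ((2 * C ^ 2 + D) * (ζ.2.2⁻¹ * F + m₀)) +
        B ^ 2 / (σ / 2) ^ 2 * (ζ.2.2⁻¹ * F + m₀) := by
      gcongr
      · nlinarith [mul_nonneg (sq_nonneg C) hγF, mul_nonneg hD0 hm₀]
      · linarith
    _ = _ := by ring
end

section
/- Let G ∈ M_N(ℂ), let M be a q×N complex matrix, and let γ, c, C > 0 and a Hermitian Σ ∈ M_N(ℂ) satisfy ‖Σ‖ ≤ C, Im(ΣG) ≥ cγI, and Σ + C·M*M ≥ cI. Then there is K > 0 depending only on c and C such that for every f ∈ L²((0,∞);ℂ^N) and every continuously differentiable u : [0,∞) → ℂ^N belonging to L²((0,∞);ℂ^N) and satisfying u′(x) + iGu(x) = f(x) for all x > 0, one has γ‖u‖²_{L²((0,∞))} + |u(0)|² ≤ K(γ^{−1}‖f‖²_{L²((0,∞))} + |Mu(0)|²). (Existence of a bounded Kreiss symmetrizer implies the maximal estimate.) -/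
open Matrix MeasureTheory
open scoped ComplexOrder

/-- The "imaginary part" `Im X := (X − X*)/(2i)` of a square complex matrix. -/
noncomputable def matIm {n : ℕ} (X : Matrix (Fin n) (Fin n) ℂ) : Matrix (Fin n) (Fin n) ℂ :=
  (2 * Complex.I)⁻¹ • (X - Xᴴ)

/-- The operator norm of a complex matrix acting between Euclidean spaces. -/
noncomputable def matOpNorm {m n : ℕ} (A : Matrix (Fin m) (Fin n) ℂ) : ℝ :=
  ‖LinearMap.toContinuousLinearMap (Matrix.toEuclideanLin A)‖

/-- The derivative of the quadratic form of a symmetric operator along a solution of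
`u' + i A u = f`. -/
theorem ContinuousLinearMap.hasDerivAt_re_inner_of_isSymmetric
    {E : Type*} [NormedAddCommGroup E] [InnerProductSpace ℂ E] {T A : E →L[ℂ] E}
    (hT : (T : E →ₗ[ℂ] E).IsSymmetric) {u : ℝ → E} {g : E} {x : ℝ}
    (hu : HasDerivAt u (g - Complex.I • A (u x)) x) :
    HasDerivAt (fun y => (inner ℂ (T (u y)) (u y)).re)
      (2 * (inner ℂ (T (u x)) g).re + 2 * (inner ℂ (T (u x)) (A (u x))).im) x := by
  have h1 : HasDerivAt (fun y => T (u y)) (T (g - Complex.I • A (u x))) x :=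
    (T.restrictScalars ℝ).hasFDerivAt.comp_hasDerivAt x hu
  have h2 := Complex.reCLM.hasFDerivAt.comp_hasDerivAt x (h1.inner ℂ hu)
  refine h2.congr_deriv ?_
  have h3 : inner ℂ (T (g - Complex.I • A (u x))) (u x)
      = inner ℂ (g - Complex.I • A (u x)) (T (u x)) := hT _ _
  rw [h3, ← inner_conj_symm (g - Complex.I • A (u x)) (T (u x))]
  rw [Complex.reCLM_apply, Complex.add_re, Complex.conj_re]
  simp only [inner_sub_right, inner_smul_right, Complex.sub_re, Complex.I_mul_re]
  ring

/-- Energy estimate for `u' + i A u = f` on a half-line, given a symmetric operator `T` such that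
`Im (T A)` is bounded below. -/
theorem ContinuousLinearMap.energy_estimate_of_symmetrizer
    {E : Type*} [NormedAddCommGroup E] [InnerProductSpace ℂ E] {T A : E →L[ℂ] E}
    {C a : ℝ} (ha : 0 < a) (hT : (T : E →ₗ[ℂ] E).IsSymmetric)
    (hC : ‖T‖ ≤ C)
    (hTA : ∀ v, a * ‖v‖ ^ 2 ≤ (inner ℂ (T v) (A v)).im) {f u : ℝ → E}
    (hu : ContinuousOn u (Set.Ici 0))
    (hderiv : ∀ x, 0 < x → HasDerivAt u (f x - Complex.I • A (u x)) x)
    (hu2 : IntegrableOn (fun x => ‖u x‖ ^ 2) (Set.Ioi 0))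
    (hf2 : IntegrableOn (fun x => ‖f x‖ ^ 2) (Set.Ioi 0)) :
    a * (∫ x in Set.Ioi (0 : ℝ), ‖u x‖ ^ 2) + (inner ℂ (T (u 0)) (u 0)).re ≤
      C ^ 2 / a * ∫ x in Set.Ioi (0 : ℝ), ‖f x‖ ^ 2 := by
  set φ : ℝ → ℝ := fun y => (inner ℂ (T (u y)) (u y)).re with hφ
  set φ' : ℝ → ℝ := fun x =>
    2 * (inner ℂ (T (u x)) (f x)).re + 2 * (inner ℂ (T (u x)) (A (u x))).im with hφ'
  have hC0 : 0 ≤ C := (norm_nonneg T).trans hC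
  have hd : ∀ x ∈ Set.Ioi (0 : ℝ), HasDerivAt φ (φ' x) x := fun x hx =>
    ContinuousLinearMap.hasDerivAt_re_inner_of_isSymmetric hT (hderiv x hx)
  have hTv : ∀ v, ‖T v‖ ≤ C * ‖v‖ := fun v => T.le_of_opNorm_le hC v
  have hcont : ContinuousOn φ (Set.Ici 0) :=
    Complex.continuous_re.comp_continuousOn ((T.continuous.comp_continuousOn hu).inner hu)
  have hTw : ∀ v w, ‖inner ℂ (T v) w‖ ≤ C * ‖v‖ * ‖w‖ := fun v w =>
    (norm_inner_le_norm _ _).trans (by gcongr; exact hTv v)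
  have hre : ∀ v w, |(inner ℂ (T v) w).re| ≤ C * ‖v‖ * ‖w‖ := fun v w =>
    (Complex.abs_re_le_norm _).trans (hTw v w)
  have him : ∀ v, |(inner ℂ (T v) (A v)).im| ≤ C * ‖A‖ * ‖v‖ ^ 2 := fun v =>
    calc |(inner ℂ (T v) (A v)).im| ≤ C * ‖v‖ * ‖A v‖ :=
          (Complex.abs_im_le_norm _).trans (hTw v _)
      _ ≤ C * ‖v‖ * (‖A‖ * ‖v‖) := by gcongr; exact A.le_opNorm v
      _ = C * ‖A‖ * ‖v‖ ^ 2 := by ring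
  have hmeas : AEStronglyMeasurable φ' (volume.restrict (Set.Ioi 0)) :=
    (measurable_deriv φ).aestronglyMeasurable.congr
      ((ae_restrict_mem measurableSet_Ioi).mono fun x hx => (hd x hx).deriv)
  have hφint : IntegrableOn φ (Set.Ioi 0) := by
    refine Integrable.mono' (hu2.const_mul C)
      ((hcont.mono Set.Ioi_subset_Ici_self).aestronglyMeasurable measurableSet_Ioi)
      (Filter.Eventually.of_forall fun x => ?_)
    exact (hre (u x) (u x)).trans_eq (by ring)
  have hφ'int : IntegrableOn φ' (Set.Ioi 0) := by
    refine Integrable.mono' ((hu2.const_mul (C + 2 * (C * ‖A‖))).add (hf2.const_mul C)) hmeas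
      (Filter.Eventually.of_forall fun x => ?_)
    have h1 := abs_le.1 (hre (u x) (f x))
    have h2 := abs_le.1 (him (u x))
    have h3 := mul_nonneg hC0 (sq_nonneg (‖u x‖ - ‖f x‖))
    simp only [hφ', Real.norm_eq_abs, Pi.add_apply]
    rw [abs_le]
    constructor <;> nlinarith
  have hlim := tendsto_zero_of_hasDerivAt_of_integrableOn_Ioi hd hφ'int hφint
  have hint := integral_Ioi_of_hasDerivAt_of_tendsto (hcont 0 Set.self_mem_Ici) hd hφ'int hlim
  have hlower : ∀ x, a * ‖u x‖ ^ 2 - C ^ 2 / a * ‖f x‖ ^ 2 ≤ φ' x := fun x => by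
    have h1 := abs_le.1 (hre (u x) (f x))
    have h2 := hTA (u x)
    have h3 : 2 * (C * ‖u x‖ * ‖f x‖) ≤ a * ‖u x‖ ^ 2 + C ^ 2 / a * ‖f x‖ ^ 2 := by
      have h4 : a * ‖u x‖ ^ 2 + C ^ 2 / a * ‖f x‖ ^ 2 - 2 * (C * ‖u x‖ * ‖f x‖)
          = (a * ‖u x‖ - C * ‖f x‖) ^ 2 / a := by
        field_simp
        ring
      have h5 : 0 ≤ (a * ‖u x‖ - C * ‖f x‖) ^ 2 / a := by positivity
      linarith
    simp only [hφ']
    linarith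
  have hmono := setIntegral_mono ((hu2.const_mul a).sub (hf2.const_mul (C ^ 2 / a))) hφ'int hlower
  have hsub := integral_sub (hu2.const_mul a) (hf2.const_mul (C ^ 2 / a))
  simp only [Pi.sub_apply, integral_const_mul] at hmono hsub
  rw [hsub, hint] at hmono
  simp only [hφ] at hmono
  linarith

/-- The quadratic form of `Im X` is the imaginary part of the sesquilinear form of `X`. -/
theorem inner_toEuclideanLin_matIm_re {n : ℕ} (X : Matrix (Fin n) (Fin n) ℂ)
    (v : EuclideanSpace ℂ (Fin n)) :
    (inner ℂ v (Matrix.toEuclideanLin (matIm X) v)).re =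
      (inner ℂ v (Matrix.toEuclideanLin X v)).im := by
  have h : (2 * Complex.I)⁻¹ = -(Complex.I / 2) := by
    rw [mul_inv, Complex.inv_I]
    ring
  simp only [matIm, map_smul, map_sub, LinearMap.smul_apply, LinearMap.sub_apply,
    Matrix.toEuclideanLin_conjTranspose_eq_adjoint, inner_smul_right, inner_sub_right,
    LinearMap.adjoint_inner_right]
  rw [← inner_conj_symm (Matrix.toEuclideanLin X v) v, h]
  generalize inner ℂ v (Matrix.toEuclideanLin X v) = z
  simp
  ring

/-- Combination of an interior energy bound and a boundary bound into a single estimate. -/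
theorem le_mul_add_of_energy_bounds {c C γ I J U m s : ℝ} (hc : 0 < c) (hC : 0 < C) (hγ : 0 < γ)
    (hJ : 0 ≤ J) (hm : 0 ≤ m) (henergy : c * γ * I + s ≤ C ^ 2 / (c * γ) * J)
    (hbdry : c * U ≤ s + C * m) :
    γ * I + U ≤ (C ^ 2 / c ^ 2 + C / c) * (γ⁻¹ * J + m) :=
  calc γ * I + U ≤ (C ^ 2 / (c * γ) * J + C * m) / c := by
        rw [le_div_iff₀ hc]
        linarith
    _ = C ^ 2 / c ^ 2 * (γ⁻¹ * J) + C / c * m := by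
        field_simp
    _ ≤ (C ^ 2 / c ^ 2 + C / c) * (γ⁻¹ * J + m) := by
        have h1 : 0 ≤ C ^ 2 / c ^ 2 * m := by positivity
        have h2 : 0 ≤ C / c * (γ⁻¹ * J) := by positivity
        linarith

/-- **A bounded Kreiss symmetrizer implies the maximal estimate.**
For all `c, C > 0` there is `K > 0` (depending only on `c` and `C`) such that: whenever
`G ∈ M_N(ℂ)`, `M` is `q×N`, `γ > 0`, and a Hermitian `Σ` satisfies `‖Σ‖ ≤ C`,
`Im(ΣG) ≥ cγI` and `Σ + C·M*M ≥ cI`, then for every `f ∈ L²((0,∞);ℂ^N)` and every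
continuously differentiable `u : [0,∞) → ℂ^N` in `L²` with `u′ + iGu = f` on `(0,∞)`,
`γ‖u‖²_{L²} + |u(0)|² ≤ K(γ⁻¹‖f‖²_{L²} + |Mu(0)|²)`. -/
theorem kreiss_symmetrizer_maximal_estimate :
    ∀ c C : ℝ, 0 < c → 0 < C →
    ∃ K > (0:ℝ), ∀ (N q : ℕ) (G : Matrix (Fin N) (Fin N) ℂ)
      (M : Matrix (Fin q) (Fin N) ℂ) (S : Matrix (Fin N) (Fin N) ℂ) (γ : ℝ),
      0 < γ → S.IsHermitian → matOpNorm S ≤ C →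
      (matIm (S * G) - ((c * γ : ℝ) : ℂ) • (1 : Matrix (Fin N) (Fin N) ℂ)).PosSemidef →
      (S + ((C : ℝ) : ℂ) • (Mᴴ * M) - ((c : ℝ) : ℂ) • (1 : Matrix (Fin N) (Fin N) ℂ)).PosSemidef →
      ∀ f u : ℝ → EuclideanSpace ℂ (Fin N),
        ContinuousOn u (Set.Ici 0) →
        (∀ x : ℝ, 0 < x →
          HasDerivAt u (f x - Complex.I • (Matrix.toEuclideanLin G) (u x)) x) →
        IntegrableOn (fun x => ‖u x‖ ^ 2) (Set.Ioi 0) →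
        IntegrableOn (fun x => ‖f x‖ ^ 2) (Set.Ioi 0) →
        γ * (∫ x in Set.Ioi (0:ℝ), ‖u x‖ ^ 2) + ‖u 0‖ ^ 2 ≤
          K * (γ⁻¹ * (∫ x in Set.Ioi (0:ℝ), ‖f x‖ ^ 2)
            + ‖(Matrix.toEuclideanLin M) (u 0)‖ ^ 2) := by
  intro c C hc hC
  refine ⟨C ^ 2 / c ^ 2 + C / c, by positivity, ?_⟩
  intro N q G M S γ hγ hS hSC hIm hbd f u hu hderiv hu2 hf2
  set T : EuclideanSpace ℂ (Fin N) →L[ℂ] EuclideanSpace ℂ (Fin N) :=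
    LinearMap.toContinuousLinearMap (Matrix.toEuclideanLin S) with hT
  set A : EuclideanSpace ℂ (Fin N) →L[ℂ] EuclideanSpace ℂ (Fin N) :=
    LinearMap.toContinuousLinearMap (Matrix.toEuclideanLin G) with hA
  have hsymm : (T : EuclideanSpace ℂ (Fin N) →ₗ[ℂ] _).IsSymmetric :=
    Matrix.isSymmetric_toEuclideanLin_iff.2 hS
  have hmul : ∀ {k l m : ℕ} (X : Matrix (Fin k) (Fin l) ℂ) (Y : Matrix (Fin l) (Fin m) ℂ) v,
      Matrix.toEuclideanLin (X * Y) v = Matrix.toEuclideanLin X (Matrix.toEuclideanLin Y v) :=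
    fun X Y v => by rw [Matrix.toEuclideanLin, Matrix.toLpLin_mul (q := 2)]; rfl
  have hone : ∀ v, Matrix.toEuclideanLin (1 : Matrix (Fin N) (Fin N) ℂ) v = v :=
    fun v => by rw [Matrix.toEuclideanLin, Matrix.toLpLin_one]; rfl
  have hself : ∀ {k : ℕ} (w : EuclideanSpace ℂ (Fin k)), inner ℂ w w = ((‖w‖ ^ 2 : ℝ) : ℂ) :=
    fun w => by
      rw [inner_self_eq_norm_sq_to_K, Complex.ofReal_pow]
      rfl
  have hTA : ∀ v, c * γ * ‖v‖ ^ 2 ≤ (inner ℂ (T v) (A v)).im := fun v => by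
    have h := (Matrix.isPositive_toEuclideanLin_iff.2 hIm).re_inner_nonneg_right v
    rw [map_sub, LinearMap.sub_apply, inner_sub_right, map_smul, LinearMap.smul_apply, hone,
      inner_smul_right, hself, RCLike.re_eq_complex_re, Complex.sub_re,
      inner_toEuclideanLin_matIm_re, hmul, ← Complex.ofReal_mul, Complex.ofReal_re] at h
    have h2 : inner ℂ (T v) (A v) = inner ℂ v (T (A v)) := hsymm v (A v)
    rw [h2]
    exact sub_nonneg.1 h
  have hbdry : c * ‖u 0‖ ^ 2 ≤
      (inner ℂ (T (u 0)) (u 0)).re + C * ‖Matrix.toEuclideanLin M (u 0)‖ ^ 2 := by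
    have h := (Matrix.isPositive_toEuclideanLin_iff.2 hbd).re_inner_nonneg_right (u 0)
    rw [map_sub, LinearMap.sub_apply, inner_sub_right, map_smul, LinearMap.smul_apply, hone,
      inner_smul_right, hself, RCLike.re_eq_complex_re, Complex.sub_re,
      map_add, LinearMap.add_apply, inner_add_right, map_smul, LinearMap.smul_apply, hmul,
      inner_smul_right, Matrix.toEuclideanLin_conjTranspose_eq_adjoint,
      LinearMap.adjoint_inner_right, hself, Complex.add_re, ← Complex.ofReal_mul,
      ← Complex.ofReal_mul, Complex.ofReal_re, Complex.ofReal_re] at h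
    have h2 : inner ℂ (T (u 0)) (u 0) = inner ℂ (u 0) (T (u 0)) := hsymm (u 0) (u 0)
    rw [h2]
    exact sub_nonneg.1 h
  have henergy := ContinuousLinearMap.energy_estimate_of_symmetrizer (mul_pos hc hγ) hsymm hSC hTA
    hu hderiv hu2 hf2
  exact le_mul_add_of_energy_bounds hc hC hγ (integral_nonneg fun x => sq_nonneg _) (sq_nonneg _)
    henergy hbdry
end

section
/- Let Ā₁,…,Ā_d ∈ M_m(ℂ) and assume that for every real θ' = (θ₁,…,θ_d) ∈ ℝ^d the matrix Σ_{j=1}^d θ_jĀ_j has only real eigenvalues. Define Q(θ₀,θ₁,…,θ_d) := det(θ₀I_m + Σ_{j=1}^d θ_jĀ_j) and let Γ₊ ⊆ ℝ^{1+d} be the connected component of {θ : Q(θ) > 0} containing e₀ = (1,0,…,0). Then: (i) (0,…,0,1) ∈ Γ₊ if and only if every eigenvalue of Ā_d is a positive real number; (ii) (0,…,0,−1) ∈ Γ₊ if and only if every eigenvalue of Ā_d is a negative real number. (In the setting of the tangent system at a semisimple characteristic root, (i) characterizes the totally incoming case and (ii) the totally outgoing case.) -/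
/-- A complex matrix with positive real eigenvalues has `det (s + M) ≥ det M > 0` for `s ≥ 0`. -/
theorem det_re_le_det_smul_one_add {m : ℕ} {M : Matrix (Fin m) (Fin m) ℂ}
    (hM : ∀ μ ∈ spectrum ℂ M, μ.im = 0 ∧ 0 < μ.re) {s : ℝ} (hs : 0 ≤ s) :
    M.det.im = 0 ∧ 0 < M.det.re ∧
      M.det.re ≤ ((s : ℂ) • (1 : Matrix (Fin m) (Fin m) ℂ) + M).det.re := by
  set R := (-M).charpoly.roots with hR
  have hroot : ∀ r ∈ R, ((r.re : ℝ) : ℂ) = r ∧ r.re < 0 := by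
    intro r hr
    have h1 : r ∈ spectrum ℂ (-M) :=
      Matrix.mem_spectrum_iff_isRoot_charpoly.2 (Polynomial.isRoot_of_mem_roots hr)
    rw [← spectrum.neg_eq, Set.mem_neg] at h1
    obtain ⟨h2, h3⟩ := hM _ h1
    simp only [Complex.neg_im, neg_eq_zero, Complex.neg_re] at h2 h3
    exact ⟨Complex.ext (by simp) (by simp [h2]), by linarith⟩
  have hdet : ∀ t : ℝ, ((t : ℂ) • (1 : Matrix (Fin m) (Fin m) ℂ) + M).det =
      (((R.map fun r => t - r.re).prod : ℝ) : ℂ) := by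
    intro t
    have h1 := Matrix.eval_charpoly (-M) (t : ℂ)
    rw [sub_neg_eq_add, Matrix.scalar_apply, ← Matrix.smul_one_eq_diagonal] at h1
    rw [← h1, (IsAlgClosed.splits (-M).charpoly).eval_eq_prod_roots_of_monic
      (Matrix.charpoly_monic _)]
    refine Eq.trans ?_ (map_multiset_prod Complex.ofRealHom _).symm
    rw [Multiset.map_map]
    refine congrArg _ (Multiset.map_congr hR.symm fun r hr => ?_)
    simp [(hroot r hr).1]
  have h0 := hdet 0
  simp only [Complex.ofReal_zero, zero_smul, zero_add] at h0
  rw [hdet s, h0]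
  refine ⟨Complex.ofReal_im _, ?_, ?_⟩
  · rw [Complex.ofReal_re]
    refine Multiset.prod_pos fun x hx => ?_
    obtain ⟨r, hr, rfl⟩ := Multiset.mem_map.1 hx
    simpa using (hroot r hr).2
  · rw [Complex.ofReal_re, Complex.ofReal_re]
    refine Multiset.prod_map_le_prod_map₀ _ _ (fun r hr => ?_) fun r hr => ?_
    · have := (hroot r hr).2
      linarith
    · linarith

/-- A complex number `-s` is an eigenvalue of `M` iff `s + M` is singular. -/
theorem neg_mem_spectrum_iff_det_eq_zero {m : ℕ} (M : Matrix (Fin m) (Fin m) ℂ) (s : ℂ) :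
    -s ∈ spectrum ℂ M ↔ (s • (1 : Matrix (Fin m) (Fin m) ℂ) + M).det = 0 := by
  rw [← Set.mem_neg, spectrum.neg_eq, Matrix.mem_spectrum_iff_isRoot_charpoly, Polynomial.IsRoot,
    Matrix.eval_charpoly, sub_neg_eq_add, Matrix.scalar_apply, ← Matrix.smul_one_eq_diagonal]

/-- A matrix with real spectrum has positive spectrum iff `s + M` is nonsingular for `s ≥ 0`. -/
theorem spectrum_re_pos_iff_det_smul_one_add_ne_zero {m : ℕ} {M : Matrix (Fin m) (Fin m) ℂ}
    (hM : ∀ μ ∈ spectrum ℂ M, μ.im = 0) :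
    (∀ μ ∈ spectrum ℂ M, 0 < μ.re) ↔
      ∀ s : ℝ, 0 ≤ s → ((s : ℂ) • (1 : Matrix (Fin m) (Fin m) ℂ) + M).det ≠ 0 := by
  constructor
  · intro h s hs h0
    have := h _ ((neg_mem_spectrum_iff_det_eq_zero M s).2 h0)
    simp only [Complex.neg_re, Complex.ofReal_re] at this
    linarith
  · intro h μ hμ
    by_contra! hneg
    refine h (-μ.re) (by linarith) ((neg_mem_spectrum_iff_det_eq_zero M _).1 ?_)
    convert hμ using 1
    exact Complex.ext (by simp) (by simp [hM μ hμ])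

/-- Nonsingularity along the ray `s + M` is nonsingularity along the segment from `1` to `M`. -/
theorem det_smul_one_add_ne_zero_iff_segment {m : ℕ} (M : Matrix (Fin m) (Fin m) ℂ) :
    (∀ s : ℝ, 0 ≤ s → ((s : ℂ) • (1 : Matrix (Fin m) (Fin m) ℂ) + M).det ≠ 0) ↔
      ∀ t ∈ Set.Icc (0 : ℝ) 1,
        (((1 - t : ℝ) : ℂ) • (1 : Matrix (Fin m) (Fin m) ℂ) + (t : ℂ) • M).det ≠ 0 := by
  constructor
  · rintro h t ⟨ht0, ht1⟩
    rcases ht0.eq_or_lt with rfl | ht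
    · simp
    · have hc : (t : ℂ) ≠ 0 := by exact_mod_cast ht.ne'
      have heq : ((1 - t : ℝ) : ℂ) • (1 : Matrix (Fin m) (Fin m) ℂ) + (t : ℂ) • M =
          (t : ℂ) • ((((1 - t) / t : ℝ) : ℂ) • (1 : Matrix (Fin m) (Fin m) ℂ) + M) := by
        rw [smul_add, smul_smul]
        congr 2
        push_cast
        field_simp
      rw [heq, Matrix.det_smul]
      exact mul_ne_zero (pow_ne_zero _ hc) (h _ (div_nonneg (by linarith) ht.le))
  · intro h s hs
    have hs1 : 0 < 1 + s := by linarith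
    have hc : (1 + s : ℂ) ≠ 0 := by exact_mod_cast hs1.ne'
    have h1 := h (1 + s)⁻¹ ⟨(inv_pos.2 hs1).le, inv_le_one_of_one_le₀ (by linarith)⟩
    have heq : ((1 - (1 + s)⁻¹ : ℝ) : ℂ) • (1 : Matrix (Fin m) (Fin m) ℂ) +
        (((1 + s)⁻¹ : ℝ) : ℂ) • M =
          (((1 + s)⁻¹ : ℝ) : ℂ) • ((s : ℂ) • (1 : Matrix (Fin m) (Fin m) ℂ) + M) := by
      rw [smul_add, smul_smul]
      congr 2
      push_cast
      field_simp
      ring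
    rw [heq, Matrix.det_smul] at h1
    exact right_ne_zero_of_mul h1

/-- For a continuous linear family of matrices with real spectrum that takes the value `1` at `e`,
the component of `e` in `{det > 0}` consists of the parameters with positive spectrum. -/
theorem mem_connectedComponentIn_det_pos_iff {E : Type*} [AddCommGroup E] [Module ℝ E]
    [TopologicalSpace E] [IsTopologicalAddGroup E] [ContinuousSMul ℝ E] {m : ℕ}
    (M : E →ₗ[ℝ] Matrix (Fin m) (Fin m) ℂ) (hc : Continuous M) {e : E} (he : M e = 1)
    (hM : ∀ x, ∀ μ ∈ spectrum ℂ (M x), μ.im = 0) (v : E) :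
    v ∈ connectedComponentIn {x | (M x).det.im = 0 ∧ 0 < (M x).det.re} e ↔
      ∀ μ ∈ spectrum ℂ (M v), 0 < μ.re := by
  set S := {x | (M x).det.im = 0 ∧ 0 < (M x).det.re} with hS
  have heS : e ∈ S := by simp [hS, he]
  have hpos : ∀ x, (∀ μ ∈ spectrum ℂ (M x), 0 < μ.re) ↔ ∀ t ∈ Set.Icc (0 : ℝ) 1,
      (((1 - t : ℝ) : ℂ) • (1 : Matrix (Fin m) (Fin m) ℂ) + (t : ℂ) • M x).det ≠ 0 := fun x =>
    (spectrum_re_pos_iff_det_smul_one_add_ne_zero (hM x)).trans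
      (det_smul_one_add_ne_zero_iff_segment _)
  constructor
  · let U := {x | ∀ μ ∈ spectrum ℂ (M x), 0 < μ.re}
    let V := {x | ∃ s : ℝ, 0 ≤ s ∧
      ((s : ℂ) • (1 : Matrix (Fin m) (Fin m) ℂ) + M x).det.re < (M x).det.re}
    have hU : IsOpen U := by
      refine isOpen_iff_eventually.2 fun x hx => ?_
      simp only [U, Set.mem_ofPred_eq, hpos] at hx ⊢
      refine isCompact_Icc.eventually_forall_of_forall_eventually fun t ht => ?_
      have hcont : Continuous fun z : E × ℝ =>
          (((1 - z.2 : ℝ) : ℂ) • (1 : Matrix (Fin m) (Fin m) ℂ) + (z.2 : ℂ) • M z.1).det :=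
        Continuous.matrix_det (by fun_prop)
      exact hcont.continuousAt.eventually_ne (hx t ht)
    have hV : IsOpen V := by
      have : V = ⋃ s : Set.Ici (0 : ℝ), {x |
          (((s : ℝ) : ℂ) • (1 : Matrix (Fin m) (Fin m) ℂ) + M x).det.re < (M x).det.re} := by
        ext x
        simp [V]
      rw [this]
      refine isOpen_iUnion fun s => isOpen_lt ?_ ?_
      · exact Complex.continuous_re.comp (Continuous.matrix_det (by fun_prop))
      · exact Complex.continuous_re.comp hc.matrix_det
    have hUV : Disjoint U V := by
      refine Set.disjoint_left.2 ?_
      rintro x hx ⟨s, hs, hlt⟩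
      exact hlt.not_ge (det_re_le_det_smul_one_add (fun μ hμ => ⟨hM x μ hμ, hx μ hμ⟩) hs).2.2
    have hSUV : S ⊆ U ∪ V := by
      intro x hx
      by_cases hxV : x ∈ V
      · exact Or.inr hxV
      · refine Or.inl ((spectrum_re_pos_iff_det_smul_one_add_ne_zero (hM x)).2 fun s hs h0 => ?_)
        refine hxV ⟨s, hs, ?_⟩
        rw [h0]
        exact hx.2
    have heU : e ∈ U := by
      refine (spectrum_re_pos_iff_det_smul_one_add_ne_zero (hM e)).2 fun s hs => ?_
      have h1 : (s : ℂ) + 1 ≠ 0 := by exact_mod_cast (by linarith : (0 : ℝ) < s + 1).ne'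
      rw [he, show (s : ℂ) • (1 : Matrix (Fin m) (Fin m) ℂ) + 1 = ((s : ℂ) + 1) • 1 by
        rw [add_smul, one_smul], Matrix.det_smul, Matrix.det_one, mul_one]
      exact pow_ne_zero _ h1
    exact fun hv => isPreconnected_connectedComponentIn.subset_left_of_subset_union hU hV hUV
      ((connectedComponentIn_subset S e).trans hSUV) ⟨e, mem_connectedComponentIn heS, heU⟩ hv
  · intro hv
    refine (convex_segment e v).isPreconnected.subset_connectedComponentIn
      (left_mem_segment ℝ e v) ?_ (right_mem_segment ℝ e v)
    rintro x ⟨a, t, ha, ht, hat, rfl⟩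
    have hMx : M (a • e + t • v) = (a : ℂ) • 1 + (t : ℂ) • M v := by
      simp [he]
    have hx : ∀ μ ∈ spectrum ℂ (M (a • e + t • v)), 0 < μ.re := by
      refine (hpos _).2 fun r hr => ?_
      have h1 := (hpos v).1 hv (r * t) ⟨mul_nonneg hr.1 ht, mul_le_one₀ hr.2 ht (by linarith)⟩
      convert h1 using 2
      rw [hMx, smul_add, smul_smul, smul_smul, ← add_assoc, ← add_smul]
      obtain rfl : a = 1 - t := by linarith
      congr 2 <;> push_cast <;> ring
    have h2 := det_re_le_det_smul_one_add (fun μ hμ => ⟨hM _ μ hμ, hx μ hμ⟩) le_rfl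
    exact ⟨h2.1, h2.2.1⟩


/-- **Characterization of totally incoming/outgoing directions via the hyperbolicity cone.**
Let `Ā₁,…,Ā_{d+1} ∈ M_m(ℂ)` (the family `A : Fin (d+1) → M_m(ℂ)`, with `Ā_d = A (Fin.last d)`
the distinguished last matrix) and assume that for every real `θ'` the matrix `Σ θ'_j Ā_j`
has only real eigenvalues.  Define `Q(θ₀,θ') := det(θ₀I_m + Σ θ'_j Ā_j)` (a complex number
which is real and of sign `Q(θ) > 0` iff its imaginary part vanishes and its real part is
positive), and let `Γ₊` be the connected component of `{θ : Q(θ) > 0}` containing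
`e₀ = (1,0,…,0)`.  Then:
(i) `(0,…,0,1) ∈ Γ₊` iff every eigenvalue of `Ā_d` is a positive real number;
(ii) `(0,…,0,−1) ∈ Γ₊` iff every eigenvalue of `Ā_d` is a negative real number. -/
theorem totally_nonglancing_cone_characterization {m d : ℕ}
    (A : Fin (d + 1) → Matrix (Fin m) (Fin m) ℂ)
    (hreal : ∀ θ' : Fin (d + 1) → ℝ,
      ∀ μ ∈ spectrum ℂ (∑ j, (θ' j : ℂ) • A j), μ.im = 0) :
    (((0:ℝ), Pi.single (Fin.last d) (1:ℝ)) ∈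
        connectedComponentIn
          {θ : ℝ × (Fin (d + 1) → ℝ) |
            (((θ.1 : ℂ) • (1 : Matrix (Fin m) (Fin m) ℂ) + ∑ j, (θ.2 j : ℂ) • A j).det).im = 0 ∧
            0 < (((θ.1 : ℂ) • (1 : Matrix (Fin m) (Fin m) ℂ) + ∑ j, (θ.2 j : ℂ) • A j).det).re}
          ((1:ℝ), (0 : Fin (d + 1) → ℝ))
      ↔ ∀ μ ∈ spectrum ℂ (A (Fin.last d)), μ.im = 0 ∧ 0 < μ.re) ∧
    (((0:ℝ), Pi.single (Fin.last d) (-1:ℝ)) ∈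
        connectedComponentIn
          {θ : ℝ × (Fin (d + 1) → ℝ) |
            (((θ.1 : ℂ) • (1 : Matrix (Fin m) (Fin m) ℂ) + ∑ j, (θ.2 j : ℂ) • A j).det).im = 0 ∧
            0 < (((θ.1 : ℂ) • (1 : Matrix (Fin m) (Fin m) ℂ) + ∑ j, (θ.2 j : ℂ) • A j).det).re}
          ((1:ℝ), (0 : Fin (d + 1) → ℝ))
      ↔ ∀ μ ∈ spectrum ℂ (A (Fin.last d)), μ.im = 0 ∧ μ.re < 0) := by
  let M : ℝ × (Fin (d + 1) → ℝ) →ₗ[ℝ] Matrix (Fin m) (Fin m) ℂ :=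
    { toFun := fun θ => (θ.1 : ℂ) • (1 : Matrix (Fin m) (Fin m) ℂ) + ∑ j, (θ.2 j : ℂ) • A j
      map_add' := fun x y => by
        simp only [Prod.fst_add, Prod.snd_add, Pi.add_apply, Complex.ofReal_add, add_smul,
          Finset.sum_add_distrib]
        abel
      map_smul' := fun c x => by
        simp [mul_smul, Finset.smul_sum] }
  have hc : Continuous M := by
    change Continuous fun θ : ℝ × (Fin (d + 1) → ℝ) =>
      (θ.1 : ℂ) • (1 : Matrix (Fin m) (Fin m) ℂ) + ∑ j, (θ.2 j : ℂ) • A j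
    fun_prop
  have he : M ((1 : ℝ), (0 : Fin (d + 1) → ℝ)) = 1 := by
    simp [M]
  have hM : ∀ x, ∀ μ ∈ spectrum ℂ (M x), μ.im = 0 := by
    intro x μ hμ
    have h1 : μ - (x.1 : ℂ) ∈ spectrum ℂ (∑ j, (x.2 j : ℂ) • A j) := by
      rw [← spectrum.add_mem_add_iff (s := (x.1 : ℂ)), sub_add_cancel,
        Algebra.algebraMap_eq_smul_one]
      exact hμ
    simpa using hreal x.2 _ h1
  have hsingle : ∀ c : ℝ, M ((0 : ℝ), Pi.single (Fin.last d) c) = (c : ℂ) • A (Fin.last d) := by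
    intro c
    simp only [M, LinearMap.coe_mk, AddHom.coe_mk, Complex.ofReal_zero, zero_smul, zero_add]
    rw [Finset.sum_eq_single (Fin.last d) (fun j _ hj => by simp [hj]) (by simp), Pi.single_eq_same]
  have hA : ∀ μ ∈ spectrum ℂ (A (Fin.last d)), μ.im = 0 := by
    simpa only [hsingle, Complex.ofReal_one, one_smul] using hM (0, Pi.single (Fin.last d) 1)
  constructor
  · refine (mem_connectedComponentIn_det_pos_iff M hc he hM _).trans ?_
    rw [hsingle, Complex.ofReal_one, one_smul]
    exact forall₂_congr fun μ hμ => (and_iff_right (hA μ hμ)).symm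
  · refine (mem_connectedComponentIn_det_pos_iff M hc he hM _).trans ?_
    rw [hsingle, Complex.ofReal_neg, Complex.ofReal_one, neg_one_smul, ← spectrum.neg_eq]
    simp only [Set.mem_neg]
    rw [Set.forall_neg_mem]
    refine forall₂_congr fun μ hμ => ?_
    rw [and_iff_right (hA μ hμ), Complex.neg_re, neg_pos]
end

section
/- Let π be a homogeneous polynomial on ℝ^{1+d}, in variables (τ,ξ) ∈ ℝ×ℝ^d, that is hyperbolic in the direction dt = (1,0,…,0). Let (τ̄,ξ̄) ∈ ℝ^{1+d} with (τ̄,ξ̄) ≠ 0, and let m ≥ 1 be the multiplicity of τ̄ as a root of the one-variable polynomial τ ↦ π(τ,ξ̄). Then every term of total degree strictly less than m in the Taylor expansion of π at (τ̄,ξ̄) vanishes, so that π(τ̄+τ, ξ̄+ξ) = π^{(m)}(τ,ξ) + O(|(τ,ξ)|^{m+1}) with π^{(m)} homogeneous of degree m, and the polynomial π^{(m)} is itself hyperbolic in the direction dt. -/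
/-- A polynomial `π` on `ℝ^n` is hyperbolic in the direction `ν` if `π(ν) ≠ 0` and, for every
real vector `η'` not proportional to `ν`, all complex roots `z` of `π(zν + η') = 0` are
real. -/
def IsHyperbolicDir {n : ℕ} (p : MvPolynomial (Fin n) ℝ) (ν : Fin n → ℝ) : Prop :=
  MvPolynomial.eval ν p ≠ 0 ∧
  ∀ η' : Fin n → ℝ, (¬ ∃ c : ℝ, η' = c • ν) →
    ∀ z : ℂ, MvPolynomial.aeval (fun i => z * (ν i : ℂ) + (η' i : ℂ)) p = 0 → z.im = 0

open Filter Topology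

theorem Polynomial.norm_eval_le_of_ne_zero_on_ball {h : Polynomial ℂ} {N : ℕ}
    (hN : h.natDegree ≤ N) {r : ℝ} (hr : 0 < r) (h0 : ∀ z : ℂ, ‖z‖ < r → h.eval z ≠ 0) (z : ℂ) :
    ‖h.eval z‖ ≤ ‖h.eval 0‖ * (1 + ‖z‖ / r) ^ N := by
  have hs := IsAlgClosed.splits h
  have hev : ∀ w, h.eval w = h.leadingCoeff * (h.roots.map (fun a => w - a)).prod :=
    fun w => hs.eval_eq_prod_roots w
  have key : ∀ s : Multiset ℂ, (∀ a ∈ s, r ≤ ‖a‖) →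
      ‖(s.map (fun a => z - a)).prod‖ ≤
        ‖(s.map (fun a => 0 - a)).prod‖ * (1 + ‖z‖ / r) ^ s.card := by
    intro s
    induction s using Multiset.induction_on with
    | empty => simp
    | cons a s ih =>
      intro hs
      simp only [Multiset.map_cons, Multiset.prod_cons, norm_mul, Multiset.card_cons, pow_succ]
      have ha : r ≤ ‖a‖ := hs a (by simp)
      have h1 : ‖z - a‖ ≤ ‖0 - a‖ * (1 + ‖z‖ / r) := by
        have h2 : ‖z‖ ≤ ‖a‖ * (‖z‖ / r) := by
          rw [mul_div_assoc', le_div_iff₀ hr, mul_comm]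
          gcongr
        rw [zero_sub, norm_neg]
        linarith [norm_sub_le z a]
      calc _ ≤ (‖0 - a‖ * (1 + ‖z‖ / r)) *
            (‖(s.map (fun a => 0 - a)).prod‖ * (1 + ‖z‖ / r) ^ s.card) := by
              gcongr
              exact ih fun b hb => hs b (by simp [hb])
        _ = _ := by ring
  have hroots : ∀ a ∈ h.roots, r ≤ ‖a‖ := by
    intro a ha
    by_contra! hlt
    exact h0 a hlt (Polynomial.isRoot_of_mem_roots ha)
  rw [hev z, hev 0, norm_mul, norm_mul, mul_assoc]
  gcongr
  refine (key _ hroots).trans ?_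
  gcongr
  · have : 0 ≤ ‖z‖ / r := by positivity
    linarith
  · exact (Polynomial.card_roots' h).trans hN

theorem MvPolynomial.norm_aeval_add_le {σ : Type*} (p : MvPolynomial σ ℝ) (w u : σ → ℂ) {r : ℝ}
    (hr : 0 < r) (h0 : ∀ z : ℂ, ‖z‖ < r → aeval (w + z • u) p ≠ 0) :
    ‖aeval (w + u) p‖ ≤ ‖aeval w p‖ * (1 + 1 / r) ^ p.totalDegree := by
  let l : σ → Polynomial ℂ := fun i => Polynomial.C (w i) + Polynomial.C (u i) * Polynomial.X
  let h : Polynomial ℂ := aeval l (map (algebraMap ℝ ℂ) p)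
  have hev : ∀ z : ℂ, h.eval z = aeval (w + z • u) p := by
    intro z
    rw [← Polynomial.coe_aeval_eq_eval]
    simp only [h, aeval_map_algebraMap]
    rw [← AlgHom.restrictScalars_apply ℝ (Polynomial.aeval z), comp_aeval_apply]
    congr 2
    ext i
    simp [l, mul_comm (u i)]
  have hdeg : h.natDegree ≤ p.totalDegree * 1 := by
    refine aeval_natDegree_le _ (Finset.sup_mono (support_map_subset _ _)) l fun i => ?_
    simp only [l]
    compute_degree
  have := Polynomial.norm_eval_le_of_ne_zero_on_ball (hdeg.trans_eq (mul_one _)) hr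
    (fun z hz => by rw [hev]; exact h0 z hz) 1
  simpa [hev] using this

theorem MvPolynomial.aeval_smul_of_isHomogeneous {σ R A : Type*} [CommSemiring R] [CommSemiring A]
    [Algebra R A] {p : MvPolynomial σ R} {n : ℕ} (hp : p.IsHomogeneous n) (c : A) (w : σ → A) :
    aeval (c • w) p = c ^ n * aeval w p := by
  rw [aeval_def, aeval_def, eval₂_eq, eval₂_eq, Finset.mul_sum]
  refine Finset.sum_congr rfl fun e he => ?_
  have : ∑ i ∈ e.support, e i = n := by
    simpa [Finsupp.weight_apply, Finsupp.sum] using hp (mem_support_iff.mp he)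
  simp only [Pi.smul_apply, smul_eq_mul, mul_pow, Finset.prod_mul_distrib,
    Finset.prod_pow_eq_pow_sum, this]
  ring

theorem MvPolynomial.continuous_aeval_complex {σ : Type*} (p : MvPolynomial σ ℝ) :
    Continuous fun w : σ → ℂ => aeval w p := by
  have h := (map (algebraMap ℝ ℂ) p).continuous_eval
  simp only [eval_map] at h
  exact h

theorem MvPolynomial.tendsto_aeval_smul_div_pow {σ : Type*} (q : MvPolynomial σ ℝ) (k : ℕ)
    (hlow : ∀ j < k, homogeneousComponent j q = 0) (w : σ → ℂ) :
    Tendsto (fun s : ℝ => ((s : ℂ) ^ k)⁻¹ * aeval ((s : ℂ) • w) q) (𝓝[>] 0)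
      (𝓝 (aeval w (homogeneousComponent k q))) := by
  let F : ℝ → ℂ := fun s => ∑ j ∈ Finset.range (q.totalDegree + 1),
    (s : ℂ) ^ (j - k) * aeval w (homogeneousComponent j q)
  have hF : Continuous F := by fun_prop
  have hF0 : F 0 = aeval w (homogeneousComponent k q) := by
    simp only [F]
    rw [Finset.sum_eq_single k]
    · simp
    · intro j _ hjk
      rcases lt_or_gt_of_ne hjk with h | h
      · simp [hlow j h]
      · simp [Nat.sub_ne_zero_of_lt h]
    · intro hk
      rw [homogeneousComponent_eq_zero k q (by simpa using hk)]
      simp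
  rw [← hF0]
  refine (hF.tendsto 0 |>.mono_left nhdsWithin_le_nhds).congr' ?_
  filter_upwards [self_mem_nhdsWithin] with s hs
  have hs0 : (s : ℂ) ≠ 0 := by exact_mod_cast (ne_of_gt hs)
  conv_rhs => rw [← sum_homogeneousComponent q, map_sum, Finset.mul_sum]
  refine Finset.sum_congr rfl fun j _ => ?_
  rw [aeval_smul_of_isHomogeneous (homogeneousComponent_isHomogeneous j q)]
  rcases lt_or_ge j k with h | h
  · simp [hlow j h]
  · obtain ⟨e, rfl⟩ := Nat.exists_eq_add_of_le h
    rw [Nat.add_sub_cancel_left, pow_add]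
    field_simp

theorem MvPolynomial.aeval_add_C {σ R A : Type*} [CommSemiring R] [CommSemiring A] [Algebra R A]
    (p : MvPolynomial σ R) (x : σ → R) (w : σ → A) :
    aeval w (bind₁ (fun i => X i + C (x i)) p) = aeval (fun i => w i + algebraMap R A (x i)) p := by
  simp [aeval_bind₁]

/-- A Hurwitz-type statement: if the dilations of `p` around `x` have no zero near `w`, then the
leading part of `p` at `x` does not vanish at `w`. -/
theorem MvPolynomial.aeval_leadingPart_ne_zero {σ : Type*} [Fintype σ] (p : MvPolynomial σ ℝ)
    (x : σ → ℝ) (k : ℕ) (q : MvPolynomial σ ℝ) (hq : q = bind₁ (fun i => X i + C (x i)) p)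
    (hlow : ∀ j < k, homogeneousComponent j q = 0) (hk : homogeneousComponent k q ≠ 0)
    (w : σ → ℂ) {δ : ℝ} (hδ : 0 < δ)
    (hw : ∀ v : σ → ℂ, ‖v‖ < δ → ∀ s : ℝ, 0 < s →
      aeval (fun i => (s : ℂ) * (w i + v i) + x i) p ≠ 0) :
    aeval w (homogeneousComponent k q) ≠ 0 := by
  intro hzero
  have hqp : ∀ w : σ → ℂ, aeval w q = aeval (fun i => w i + (x i : ℂ)) p := fun w => by
    rw [hq, aeval_add_C]
    rfl
  have hall : ∀ u : σ → ℂ, aeval (w + u) (homogeneousComponent k q) = 0 := by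
    intro u
    have hr : 0 < δ / (‖u‖ + 1) := by positivity
    have h1 := (tendsto_aeval_smul_div_pow q k hlow (w + u)).norm
    have h2 := ((tendsto_aeval_smul_div_pow q k hlow w).norm).mul_const
      ((1 + 1 / (δ / (‖u‖ + 1))) ^ q.totalDegree)
    rw [hzero, norm_zero, zero_mul] at h2
    refine norm_le_zero_iff.mp (le_of_tendsto_of_tendsto h1 h2 ?_)
    filter_upwards [self_mem_nhdsWithin] with s hs
    rw [norm_mul, norm_mul, mul_assoc, smul_add]
    gcongr
    refine norm_aeval_add_le q _ _ hr fun z hz => ?_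
    rw [hqp]
    convert hw (z • u) ?_ s hs using 3
    · ext i
      simp
      ring
    · rw [norm_smul]
      rw [lt_div_iff₀ (by positivity)] at hz
      nlinarith [norm_nonneg z, norm_nonneg u]
  refine hk ((homogeneousComponent_isHomogeneous k q).eq_zero_of_forall_eval_eq_zero fun r => ?_)
  have := hall ((fun i => (r i : ℂ)) - w)
  rw [add_sub_cancel] at this
  have h3 : aeval (fun i => (r i : ℂ)) (homogeneousComponent k q) =
      ((eval r (homogeneousComponent k q) : ℝ) : ℂ) := by
    exact aeval_algebraMap_apply ℂ r (homogeneousComponent k q)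
  rw [h3] at this
  exact_mod_cast this

/-- Openness of the hyperbolicity cone around `ν`, in quantitative form. -/
theorem MvPolynomial.exists_ball_aeval_ne_zero {σ : Type*} [Fintype σ] {p : MvPolynomial σ ℝ}
    {n : ℕ} (hp : p.IsHomogeneous n) (ν : σ → ℝ) (hν : aeval (fun i => (ν i : ℂ)) p ≠ 0)
    (hreal : ∀ (y : σ → ℝ) (z : ℂ), z.im ≠ 0 → aeval (fun i => (y i : ℂ) + z * ν i) p ≠ 0) :
    ∃ δ > 0, ∀ θ : σ → ℝ, (∀ i, |θ i - ν i| < δ) → ∀ (y : σ → ℝ) (a : ℝ) (ζ : ℂ), 0 < a →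
      0 ≤ ζ.im → aeval (fun i => (y i : ℂ) + (a * Complex.I) * ν i + ζ * θ i) p ≠ 0 := by
  have hcont := p.continuous_aeval_complex
  obtain ⟨δ, hδ, hball⟩ := Metric.eventually_nhds_iff.mp
    (hcont.continuousAt.eventually_ne hν)
  refine ⟨δ / 2, by positivity, fun θ hθ y a₀ ζ₀ ha₀ hζ₀ h0 => ?_⟩
  let f : ℝ → ℂ → σ → ℂ := fun a ζ i => (y i : ℂ) + (a * Complex.I) * ν i + ζ * θ i
  have hf : Continuous fun x : ℝ × ℂ => aeval (f x.1 x.2) p := hcont.comp (by fun_prop)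
  let Z : Set (ℝ × ℂ) := {x | a₀ ≤ x.1 ∧ 0 ≤ x.2.im ∧ aeval (f x.1 x.2) p = 0}
  have hZclosed : IsClosed Z :=
    (isClosed_le continuous_const continuous_fst).inter
      ((isClosed_le continuous_const (Complex.continuous_im.comp continuous_snd)).inter
        (isClosed_eq hf continuous_const))
  have hZbdd : Bornology.IsBounded Z := by
    refine (Metric.isBounded_closedBall (x := (0 : ℝ × ℂ)) (r := 2 * ‖y‖ / δ)).subset ?_
    rintro ⟨a, ζ⟩ ⟨ha, hζ, hz⟩
    simp only at ha hζ hz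
    set c : ℂ := a * Complex.I + ζ with hc
    have hapos : 0 < a := ha₀.trans_le ha
    have hcim : c.im = a + ζ.im := by simp [hc]
    have hcre : c.re = ζ.re := by simp [hc]
    have hζc : ‖ζ‖ ≤ ‖c‖ := by
      rw [Complex.norm_def, Complex.norm_def]
      refine Real.sqrt_le_sqrt ?_
      rw [Complex.normSq_apply, Complex.normSq_apply, hcim, hcre]
      nlinarith
    have hac : a ≤ ‖c‖ := by
      have := (le_abs_self _).trans (Complex.abs_im_le_norm c)
      linarith
    have hcpos : 0 < ‖c‖ := hapos.trans_le hac
    have hc0 : c ≠ 0 := norm_pos_iff.mp hcpos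
    suffices hcR : ‖c‖ ≤ 2 * ‖y‖ / δ by
      rw [mem_closedBall_zero_iff, Prod.norm_def]
      refine max_le ?_ (hζc.trans hcR)
      rw [Real.norm_of_nonneg hapos.le]
      exact hac.trans hcR
    by_contra! hlt
    rw [div_lt_iff₀ hδ] at hlt
    have hw : f a ζ = c • (c⁻¹ • f a ζ) := by rw [smul_inv_smul₀ hc0]
    rw [hw, aeval_smul_of_isHomogeneous hp] at hz
    refine hball ?_ ((mul_eq_zero.mp hz).resolve_left (pow_ne_zero n hc0))
    rw [dist_pi_lt_iff hδ]
    intro i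
    rw [Complex.dist_eq]
    have heq : (c⁻¹ • f a ζ) i - ν i = c⁻¹ * (y i + ζ * (θ i - ν i : ℝ)) := by
      rw [eq_inv_mul_iff_mul_eq₀ hc0, mul_sub, Pi.smul_apply, smul_eq_mul, mul_inv_cancel_left₀ hc0]
      simp only [f, hc]
      push_cast
      ring
    rw [heq, norm_mul, norm_inv, inv_mul_lt_iff₀ hcpos]
    have h1 : ‖(y i : ℂ)‖ ≤ ‖y‖ := by
      rw [Complex.norm_real]
      exact norm_le_pi_norm y i
    have h2 : ‖ζ * (θ i - ν i : ℝ)‖ ≤ ‖c‖ * (δ / 2) := by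
      rw [norm_mul, Complex.norm_real]
      gcongr
      exact (hθ i).le
    have h3 := norm_add_le (y i : ℂ) (ζ * (θ i - ν i : ℝ))
    nlinarith
  obtain ⟨⟨a, ζ⟩, ⟨ha, hζ, hz⟩, hmax⟩ :=
    (Metric.isCompact_of_isClosed_isBounded hZclosed hZbdd).exists_isMaxOn
      ⟨(a₀, ζ₀), le_rfl, hζ₀, h0⟩ continuous_fst.continuousOn
  simp only at ha hζ hz
  let u : σ → ℂ := fun i => (-(ζ.im * Complex.I)) * θ i
  have hline : ∀ (b : ℝ) (z : ℂ), f b ζ + z • u = f b (ζ - z * (ζ.im * Complex.I)) := by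
    intro b z
    ext i
    simp only [f, u, Pi.add_apply, Pi.smul_apply, smul_eq_mul]
    ring
  have hrealpt : ∀ b t : ℝ, 0 < b → aeval (f b t) p ≠ 0 := by
    intro b t hb
    convert hreal (fun i => y i + t * θ i) (b * Complex.I) (by simpa using hb.ne') using 3
    ext i
    simp only [f]
    push_cast
    ring
  have hre : ζ - 1 * (ζ.im * Complex.I) = (ζ.re : ℂ) := by
    rw [one_mul, sub_eq_iff_eq_add, Complex.re_add_im]
  have hζpos : 0 < ζ.im := by
    refine hζ.lt_of_ne fun h => hrealpt a ζ.re (ha₀.trans_le ha) ?_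
    rw [← hre, ← h]
    simpa using hz
  refine hrealpt a ζ.re (ha₀.trans_le ha) (norm_le_zero_iff.mp ?_)
  have h1 : Tendsto (fun b => ‖aeval (f b ζ.re) p‖) (𝓝[>] a) (𝓝 ‖aeval (f a ζ.re) p‖) :=
    ((hf.comp (by fun_prop : Continuous fun b : ℝ => (b, (ζ.re : ℂ)))).norm.tendsto a).mono_left
      nhdsWithin_le_nhds
  have h2 : Tendsto (fun b => ‖aeval (f b ζ) p‖ * (1 + 1 / 1) ^ p.totalDegree) (𝓝[>] a)
      (𝓝 (‖aeval (f a ζ) p‖ * (1 + 1 / 1) ^ p.totalDegree)) :=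
    (((hf.comp (by fun_prop : Continuous fun b : ℝ => (b, ζ))).norm.mul_const _).tendsto
      a).mono_left nhdsWithin_le_nhds
  rw [hz, norm_zero, zero_mul] at h2
  refine le_of_tendsto_of_tendsto h1 h2 ?_
  filter_upwards [self_mem_nhdsWithin] with b hb
  rw [← hre, ← hline, one_smul]
  refine norm_aeval_add_le p _ u one_pos fun z hz1 hz2 => ?_
  rw [hline] at hz2
  have hmem : (b, ζ - z * (ζ.im * Complex.I)) ∈ Z := ⟨ha.trans (le_of_lt hb), ?_, hz2⟩
  · have hle : b ≤ a := hmax hmem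
    exact not_le.mpr hb hle
  have : z.re ≤ 1 := (Complex.re_le_norm z).trans hz1.le
  simp
  nlinarith

theorem MvPolynomial.rootMultiplicity_aeval_cons {d : ℕ} (p q : MvPolynomial (Fin (d + 1)) ℝ)
    (t : ℝ) (x : Fin d → ℝ)
    (hq : q = bind₁ (fun i => X i + C ((Fin.cons t x : Fin (d + 1) → ℝ) i)) p) (k : ℕ)
    (hlow : ∀ j < k, homogeneousComponent j q = 0)
    (hk : eval (Fin.cons 1 0) (homogeneousComponent k q) ≠ 0) :
    (aeval (Fin.cons (Polynomial.X : Polynomial ℝ) (fun j => Polynomial.C (x j))) p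
      : Polynomial ℝ).rootMultiplicity t = k := by
  let ν : Fin (d + 1) → ℝ := Fin.cons 1 0
  rw [Polynomial.rootMultiplicity_eq_natTrailingDegree]
  have h1 : (aeval (Fin.cons (Polynomial.X : Polynomial ℝ) (fun j => Polynomial.C (x j))) p
      : Polynomial ℝ).comp (Polynomial.X + Polynomial.C t) =
      aeval ((Polynomial.X : Polynomial ℝ) • fun i => Polynomial.C (ν i)) q := by
    rw [hq, aeval_add_C]
    change Polynomial.aeval (Polynomial.X + Polynomial.C t) (aeval _ p) = _
    rw [comp_aeval_apply]
    congr 2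
    ext i : 1
    refine Fin.cases ?_ (fun j => ?_) i <;> simp [ν]
  have hcoeff : ∀ j, (aeval ((Polynomial.X : Polynomial ℝ) • fun i => Polynomial.C (ν i)) q
      : Polynomial ℝ).coeff j = eval ν (homogeneousComponent j q) := by
    intro j
    have h2 : ∀ i, (aeval ((Polynomial.X : Polynomial ℝ) • fun i => Polynomial.C (ν i))
        (homogeneousComponent i q) : Polynomial ℝ) =
        Polynomial.X ^ i * Polynomial.C (eval ν (homogeneousComponent i q)) := by
      intro i
      rw [aeval_smul_of_isHomogeneous (homogeneousComponent_isHomogeneous i q)]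
      congr 1
      exact aeval_algebraMap_apply (Polynomial ℝ) ν _
    conv_lhs => rw [← sum_homogeneousComponent q, map_sum]
    simp only [h2, Polynomial.finsetSum_coeff, mul_comm (Polynomial.X ^ _),
      Polynomial.coeff_C_mul_X_pow]
    rw [Finset.sum_ite_eq]
    split_ifs with h
    · rfl
    · rw [homogeneousComponent_eq_zero j q (by simpa using h), map_zero]
  rw [h1]
  refine le_antisymm (Polynomial.natTrailingDegree_le_of_ne_zero (by rwa [hcoeff])) ?_
  refine Polynomial.le_natTrailingDegree (fun h => hk ?_) fun j hj => by
    rw [hcoeff, hlow j hj, map_zero]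
  rw [← hcoeff, h, Polynomial.coeff_zero]

theorem IsHyperbolicDir.aeval_real_add_smul_ne_zero {N n : ℕ} {p : MvPolynomial (Fin N) ℝ}
    {ν : Fin N → ℝ} (h : IsHyperbolicDir p ν) (hp : p.IsHomogeneous n) (y : Fin N → ℝ) (z : ℂ)
    (hz : z.im ≠ 0) : MvPolynomial.aeval (fun i => (y i : ℂ) + z * ν i) p ≠ 0 := by
  intro h0
  by_cases hy : ∃ c : ℝ, y = c • ν
  · obtain ⟨c, rfl⟩ := hy
    have h1 : (fun i => (((c • ν) i : ℝ) : ℂ) + z * ν i) = (c + z) • fun i => (ν i : ℂ) := by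
      ext i
      simp
      ring
    have h2 : MvPolynomial.aeval (fun i => (ν i : ℂ)) p = ((MvPolynomial.eval ν p : ℝ) : ℂ) :=
      MvPolynomial.aeval_algebraMap_apply ℂ ν p
    rw [h1, MvPolynomial.aeval_smul_of_isHomogeneous hp, h2] at h0
    refine (mul_ne_zero (pow_ne_zero n fun hc => hz ?_) (by exact_mod_cast h.1)) h0
    simpa using congrArg Complex.im hc
  · refine hz (h.2 y hy z ?_)
    simpa only [add_comm] using h0

/-- The lowest-order part of a hyperbolic polynomial at any real point is hyperbolic. -/
theorem IsHyperbolicDir.leadingPart {N n : ℕ} {p : MvPolynomial (Fin N) ℝ}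
    {ν : Fin N → ℝ} (h : IsHyperbolicDir p ν) (hp : p.IsHomogeneous n) (x : Fin N → ℝ) (k : ℕ)
    (q : MvPolynomial (Fin N) ℝ)
    (hq : q = MvPolynomial.bind₁ (fun i => MvPolynomial.X i + MvPolynomial.C (x i)) p)
    (hlow : ∀ j < k, MvPolynomial.homogeneousComponent j q = 0)
    (hk : MvPolynomial.homogeneousComponent k q ≠ 0) :
    IsHyperbolicDir (MvPolynomial.homogeneousComponent k q) ν := by
  have hofReal : ∀ r : MvPolynomial (Fin N) ℝ,
      MvPolynomial.aeval (fun i => (ν i : ℂ)) r = ((MvPolynomial.eval ν r : ℝ) : ℂ) :=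
    MvPolynomial.aeval_algebraMap_apply ℂ ν
  have hqhom := MvPolynomial.homogeneousComponent_isHomogeneous k q
  obtain ⟨δ, hδ, hball⟩ := MvPolynomial.exists_ball_aeval_ne_zero hp ν
    (by rw [hofReal]; exact_mod_cast h.1) (h.aeval_real_add_smul_ne_zero hp)
  have htube : ∀ y : Fin N → ℝ, MvPolynomial.aeval (fun i => (y i : ℂ) + 2 * Complex.I * ν i)
      (MvPolynomial.homogeneousComponent k q) ≠ 0 := by
    intro y
    refine MvPolynomial.aeval_leadingPart_ne_zero p x k q hq hlow hk _ hδ fun v hv s hs => ?_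
    have hs0 : (s : ℂ) ≠ 0 := by exact_mod_cast hs.ne'
    have h1 : (fun i => (s : ℂ) * ((y i : ℂ) + 2 * Complex.I * ν i + v i) + x i) =
        (s : ℂ) • fun i => (((x i / s + y i + (v i).re : ℝ) : ℂ) +
          ((1 : ℝ) * Complex.I) * ν i + Complex.I * ((ν i + (v i).im : ℝ) : ℂ)) := by
      ext i
      simp only [Pi.smul_apply, smul_eq_mul]
      conv_lhs => rw [← Complex.re_add_im (v i)]
      push_cast
      field_simp
      ring
    rw [h1, MvPolynomial.aeval_smul_of_isHomogeneous hp]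
    refine mul_ne_zero (pow_ne_zero n hs0)
      (hball (fun i => ν i + (v i).im) (fun i => ?_) _ 1 Complex.I one_pos (by simp))
    rw [add_sub_cancel_left]
    exact ((Complex.abs_im_le_norm _).trans (norm_le_pi_norm v i)).trans_lt hv
  refine ⟨fun h0 => htube 0 ?_, fun y _ z hz => ?_⟩
  · have h1 : (fun i => (((0 : Fin N → ℝ) i : ℝ) : ℂ) + 2 * Complex.I * ν i) =
        (2 * Complex.I) • fun i => (ν i : ℂ) := by
      ext i
      simp
    rw [h1, MvPolynomial.aeval_smul_of_isHomogeneous hqhom, hofReal, h0]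
    simp
  · by_contra hzim
    refine htube (fun i => 2 / z.im * (y i + z.re * ν i)) ?_
    have hz0 : (z.im : ℂ) ≠ 0 := by exact_mod_cast hzim
    have h1 : (fun i => ((2 / z.im * (y i + z.re * ν i) : ℝ) : ℂ) + 2 * Complex.I * ν i) =
        (2 / z.im : ℂ) • fun i => z * (ν i : ℂ) + (y i : ℂ) := by
      ext i
      simp only [Pi.smul_apply, smul_eq_mul]
      rw [show z * (ν i : ℂ) = (z.re + z.im * Complex.I) * ν i by rw [Complex.re_add_im]]
      push_cast
      field_simp
      ring
    rw [h1, MvPolynomial.aeval_smul_of_isHomogeneous hqhom, hz, mul_zero]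

/-- **Localization of hyperbolic polynomials (Proposition 2.5).**
Let `π` be a homogeneous polynomial of degree `n` on `ℝ^{1+d}`, in variables `(τ,ξ)`,
hyperbolic in the direction `dt = (1,0,…,0)`.  Let `(τ̄,ξ̄) ≠ 0` and let `m ≥ 1` be the
multiplicity of `τ̄` as a root of `τ ↦ π(τ,ξ̄)`.  Then every term of total degree `< m` in
the Taylor expansion of `π` at `(τ̄,ξ̄)` vanishes, and the homogeneous degree-`m` Taylor
term `π^{(m)}` is itself hyperbolic in the direction `dt`. -/
theorem hyperbolic_polynomial_localization {d n : ℕ}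
    (p : MvPolynomial (Fin (d + 1)) ℝ)
    (hhom : p.IsHomogeneous n)
    (hhyp : IsHyperbolicDir p (Fin.cons 1 0))
    (tb : ℝ) (xb : Fin d → ℝ)
    (hne : (Fin.cons tb xb : Fin (d + 1) → ℝ) ≠ 0)
    (m : ℕ) (hm : 1 ≤ m)
    (hmult : (MvPolynomial.aeval
        (Fin.cons (Polynomial.X : Polynomial ℝ) (fun j => Polynomial.C (xb j))) p
          : Polynomial ℝ).rootMultiplicity tb = m) :
    (∀ k < m, MvPolynomial.homogeneousComponent k
        (MvPolynomial.bind₁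
          (fun i => MvPolynomial.X i
            + MvPolynomial.C ((Fin.cons tb xb : Fin (d + 1) → ℝ) i)) p) = 0) ∧
    IsHyperbolicDir
      (MvPolynomial.homogeneousComponent m
        (MvPolynomial.bind₁
          (fun i => MvPolynomial.X i
            + MvPolynomial.C ((Fin.cons tb xb : Fin (d + 1) → ℝ) i)) p))
      (Fin.cons 1 0) := by
  set x : Fin (d + 1) → ℝ := Fin.cons tb xb
  set q := MvPolynomial.bind₁ (fun i => MvPolynomial.X i + MvPolynomial.C (x i)) p with hq
  have hex : ∃ k, MvPolynomial.homogeneousComponent k q ≠ 0 := by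
    by_contra! hall
    have hq0 : q = 0 := by
      rw [← MvPolynomial.sum_homogeneousComponent q]
      exact Finset.sum_eq_zero fun j _ => hall j
    refine hhyp.1 ?_
    have h1 := MvPolynomial.aeval_add_C p x ((Fin.cons 1 0 : Fin (d + 1) → ℝ) - x)
    rw [← hq, hq0, map_zero] at h1
    simpa [MvPolynomial.coe_aeval_eq_eval] using h1.symm
  classical
  have hlow : ∀ j < Nat.find hex, MvPolynomial.homogeneousComponent j q = 0 :=
    fun j hj => not_not.mp (Nat.find_min hex hj)
  have hlead := hhyp.leadingPart hhom x _ q hq hlow (Nat.find_spec hex)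
  have hkm : Nat.find hex = m :=
    (MvPolynomial.rootMultiplicity_aeval_cons p q tb xb hq _ hlow hlead.1).symm.trans hmult
  rw [hkm] at hlow hlead
  exact ⟨hlow, hlead⟩
end

section
/- Let A₁,…,A_d ∈ M_N(ℂ), A(ξ) := Σ_{j=1}^d ξ_jA_j, and Δ(τ,ξ) := det(τI + A(ξ)). Let (τ̄,ξ̄) ∈ ℝ^{1+d} be such that −τ̄ is a semisimple eigenvalue of A(ξ̄) of algebraic multiplicity m, i.e. ℂ^N = ker(τ̄I + A(ξ̄)) ⊕ range(τ̄I + A(ξ̄)) with dim ker = m. Let V be an N×m matrix whose columns form a basis of ker(τ̄I + A(ξ̄)), and let W be the unique m×N matrix with WV = I_m and Wx = 0 for all x ∈ range(τ̄I + A(ξ̄)). Define the m×m matrix Ā′(ξ) := Σ_{j=1}^d ξ_j·W A_j V, and let Δ̄(τ,ξ) denote the homogeneous degree-m term of the Taylor expansion of Δ at (τ̄,ξ̄). Then there exists a nonzero constant ē such that det(τI_m + Ā′(ξ)) = ē·Δ̄(τ,ξ) for all (τ,ξ) ∈ ℝ^{1+d}. (The determinant of the tangent system equals, up to a nonzero factor,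 the principal Taylor term of the characteristic polynomial.) -/
/-- The characteristic polynomial `Δ(τ,ξ) = det(τI + Σ ξ_j A_j)` of a first-order system,
as a multivariate polynomial in the variables `(τ, ξ₁,…,ξ_d)` (variable `0` is `τ`,
variable `j.succ` is `ξ_j`). -/
noncomputable def charMvPoly {N d : ℕ} (A : Fin d → Matrix (Fin N) (Fin N) ℂ) :
    MvPolynomial (Fin (d + 1)) ℂ :=
  ((MvPolynomial.X 0 : MvPolynomial (Fin (d + 1)) ℂ)
      • (1 : Matrix (Fin N) (Fin N) (MvPolynomial (Fin (d + 1)) ℂ))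
    + ∑ j : Fin d, (MvPolynomial.X j.succ : MvPolynomial (Fin (d + 1)) ℂ)
      • (A j).map (fun z => MvPolynomial.C z)).det

/-- Evaluating the degree-`n` homogeneous component of `p` at `s` gives the coefficient of `T ^ n`
in the restriction of `p` to the line `T ↦ T • s`. -/
theorem MvPolynomial.eval_homogeneousComponent {σ R : Type*} [CommSemiring R] (s : σ → R) (n : ℕ)
    (p : MvPolynomial σ R) :
    MvPolynomial.eval s (MvPolynomial.homogeneousComponent n p)
      = (MvPolynomial.aeval (fun i => Polynomial.C (s i) * Polynomial.X) p).coeff n := by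
  induction p using MvPolynomial.induction_on' with
  | monomial u a =>
    have hline : MvPolynomial.aeval (fun i => Polynomial.C (s i) * Polynomial.X)
        (MvPolynomial.monomial u a)
          = Polynomial.C (MvPolynomial.eval s (MvPolynomial.monomial u a))
            * Polynomial.X ^ u.degree := by
      rw [MvPolynomial.aeval_monomial, MvPolynomial.eval_monomial]
      simp only [Finsupp.prod, mul_pow, Finset.prod_mul_distrib, Finset.prod_pow_eq_pow_sum,
        Polynomial.algebraMap_eq, map_mul, map_prod, map_pow, Finsupp.degree_apply, mul_assoc]
    rw [hline, Polynomial.coeff_C_mul_X_pow, MvPolynomial.homogeneousComponent_of_mem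
      ((MvPolynomial.mem_homogeneousSubmodule _ _).2
        (MvPolynomial.isHomogeneous_monomial a (rfl : u.degree = u.degree)))]
    split_ifs <;> simp
  | add p q hp hq => simp only [map_add, hp, hq, Polynomial.coeff_add]

/-- If `W V = 1`, `L V = 0` and `W L = 0`, then the coefficient of `T ^ m` in `det (L + T M)`
is `det (L + V W) * det (W M V)`. -/
theorem Matrix.coeff_det_add_X_smul {n m K : Type*} [Fintype n] [DecidableEq n] [Fintype m]
    [DecidableEq m] [Field K] (L M : Matrix n n K) (V : Matrix n m K) (W : Matrix m n K)
    (hWV : W * V = 1) (hLV : L * V = 0) (hWL : W * L = 0) (hdet : (L + V * W).det ≠ 0) :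
    (L.map Polynomial.C + (Polynomial.X : Polynomial K) • M.map Polynomial.C).det.coeff
        (Fintype.card m)
      = (L + V * W).det * (W * M * V).det := by
  have hWVC : W.map Polynomial.C * V.map Polynomial.C = 1 := by
    rw [← Matrix.map_mul, hWV, Matrix.map_one _ (map_zero _) (map_one _)]
  have hLVC : L.map Polynomial.C * V.map Polynomial.C = 0 := by
    rw [← Matrix.map_mul, hLV, Matrix.map_zero _ (map_zero _)]
  set Q : Matrix (m ⊕ n) (m ⊕ n) (Polynomial K) :=
    Matrix.fromBlocks 0 (W.map Polynomial.C) (-(M * V).map Polynomial.C)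
      ((L + V * W).map Polynomial.C + (Polynomial.X : Polynomial K) • M.map Polynomial.C) with hQ
  have hfactor : (L.map Polynomial.C + (Polynomial.X : Polynomial K) • M.map Polynomial.C).det
      = Polynomial.X ^ Fintype.card m * Q.det := by
    have hmul : Matrix.fromBlocks 1 (W.map Polynomial.C) (V.map Polynomial.C)
          ((L + V * W).map Polynomial.C + (Polynomial.X : Polynomial K) • M.map Polynomial.C)
        * Matrix.fromBlocks 1 0 (-V.map Polynomial.C) 1
        = Q * Matrix.fromBlocks ((Polynomial.X : Polynomial K) • (1 : Matrix m m _)) 0 0 1 := by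
      rw [hQ, Matrix.fromBlocks_multiply, Matrix.fromBlocks_multiply]
      simp [Matrix.map_add, Matrix.add_mul, Matrix.mul_assoc, Matrix.map_mul, hWVC, hLVC]
    have h := congrArg Matrix.det hmul
    rw [Matrix.det_mul, Matrix.det_mul, Matrix.det_fromBlocks_one₁₁, Matrix.det_fromBlocks_zero₁₂,
      Matrix.det_fromBlocks_zero₁₂] at h
    simp only [Matrix.det_one, Matrix.det_smul, mul_one] at h
    rw [mul_comm, ← h]
    congr 1
    rw [Matrix.map_add _ (map_add _), Matrix.map_mul]
    abel
  have hQ0 : Q.map (Polynomial.evalRingHom 0)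
      = Matrix.fromBlocks 0 W (-(M * V)) (L + V * W) := by
    rw [hQ, Matrix.fromBlocks_map]
    congr 1 <;> ext i j <;> simp [Matrix.map_apply, -Matrix.map_mul]
  have hinv : W * (L + V * W)⁻¹ = W := by
    have h : W * (L + V * W) = W := by
      rw [Matrix.mul_add, hWL, ← Matrix.mul_assoc, hWV, Matrix.one_mul, zero_add]
    simpa only [h] using
      Matrix.mul_nonsing_inv_cancel_right _ W (isUnit_iff_ne_zero.2 hdet)
  rw [hfactor, mul_comm, Polynomial.coeff_mul_X_pow', if_pos le_rfl, Nat.sub_self,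
    Polynomial.coeff_zero_eq_eval_zero, ← Polynomial.coe_evalRingHom, RingHom.map_det,
    RingHom.mapMatrix_apply, hQ0]
  let _ := Matrix.invertibleOfIsUnitDet _ (isUnit_iff_ne_zero.2 hdet)
  rw [Matrix.det_fromBlocks₂₂, Matrix.invOf_eq_nonsing_inv, hinv, zero_sub, Matrix.mul_neg,
    neg_neg, Matrix.mul_assoc]

/-- If the kernel and range of `L` are disjoint, the columns of `V` span the kernel of `L`, and
`W V = 1`, then `L + V W` is nonsingular. -/
theorem Matrix.det_add_mul_ne_zero {n m K : Type*} [Fintype n] [DecidableEq n] [Fintype m]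
    [DecidableEq m] [Field K] (L : Matrix n n K) (V : Matrix n m K) (W : Matrix m n K)
    (hdisj : Disjoint (LinearMap.ker L.mulVecLin) (LinearMap.range L.mulVecLin))
    (hker : LinearMap.range V.mulVecLin = LinearMap.ker L.mulVecLin) (hWV : W * V = 1) :
    (L + V * W).det ≠ 0 := by
  intro h
  obtain ⟨x, hx, hx0⟩ := Matrix.exists_mulVec_eq_zero_iff.2 h
  rw [Matrix.add_mulVec, ← Matrix.mulVec_mulVec] at hx0
  have hVW : V.mulVec (W.mulVec x) ∈ LinearMap.ker L.mulVecLin :=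
    hker ▸ LinearMap.mem_range_self V.mulVecLin (W.mulVec x)
  have hLker : L.mulVec x ∈ LinearMap.ker L.mulVecLin := by
    rw [eq_neg_of_add_eq_zero_left hx0]
    exact neg_mem hVW
  have hLx : L.mulVec x = 0 :=
    Submodule.disjoint_def.1 hdisj _ hLker (LinearMap.mem_range_self L.mulVecLin x)
  have hxker : x ∈ LinearMap.range V.mulVecLin := hker ▸ LinearMap.mem_ker.2 hLx
  obtain ⟨y, rfl⟩ := hxker
  rw [hLx, zero_add, Matrix.mulVecLin_apply, Matrix.mulVec_mulVec (M := W), hWV,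
    Matrix.one_mulVec] at hx0
  exact hx hx0

/-- The restriction of the characteristic polynomial to the line through `b` with direction `s`
is the determinant of the corresponding matrix pencil. -/
theorem aeval_bind₁_charMvPoly {N d : ℕ} (A : Fin d → Matrix (Fin N) (Fin N) ℂ)
    (s b : Fin (d + 1) → ℂ) :
    MvPolynomial.aeval (fun i => Polynomial.C (s i) * Polynomial.X)
        (MvPolynomial.bind₁ (fun i => MvPolynomial.X i + MvPolynomial.C (b i)) (charMvPoly A))
      = ((b 0 • (1 : Matrix (Fin N) (Fin N) ℂ) + ∑ j, b j.succ • A j).map Polynomial.C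
          + (Polynomial.X : Polynomial ℂ)
            • (s 0 • (1 : Matrix (Fin N) (Fin N) ℂ) + ∑ j, s j.succ • A j).map
                Polynomial.C).det := by
  rw [MvPolynomial.aeval_bind₁, charMvPoly, AlgHom.map_det]
  congr 1
  ext1 i j
  simp only [AlgHom.mapMatrix_apply, Matrix.map_apply, Matrix.add_apply, Matrix.smul_apply,
    Matrix.sum_apply, smul_eq_mul, map_add, map_mul, map_sum, MvPolynomial.aeval_X,
    MvPolynomial.aeval_C, Polynomial.algebraMap_eq, Matrix.one_apply, add_mul, mul_add,
    Finset.mul_sum, Finset.sum_add_distrib]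
  have hone : MvPolynomial.aeval
      (fun i => Polynomial.C (s i) * Polynomial.X + Polynomial.C (b i))
      (if i = j then (1 : MvPolynomial (Fin (d + 1)) ℂ) else 0)
      = Polynomial.C (if i = j then (1 : ℂ) else 0) := by
    split_ifs <;> simp
  rw [hone]
  simp only [mul_comm, mul_left_comm]
  abel


/-- **The tangent system determinant is the principal Taylor term of the characteristic
polynomial (Proposition 2.7, identity (2.18)).**
Let `A(ξ) := Σ ξ_j A_j` and `Δ(τ,ξ) := det(τI + A(ξ))`.  Let `(τ̄,ξ̄)` be real with `−τ̄` a
semisimple eigenvalue of `A(ξ̄)` of algebraic multiplicity `m` (i.e. `ℂ^N` is the direct sum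
of the kernel and the range of `L := τ̄I + A(ξ̄)`, with `dim ker L = m`).  Let `V` be an
`N×m` matrix whose columns form a basis of `ker L` and `W` the `m×N` matrix with `WV = I_m`
and `W = 0` on `range L`.  With `Ā′(ξ) := Σ ξ_j·W A_j V` and `Δ̄` the homogeneous degree-`m`
Taylor term of `Δ` at `(τ̄,ξ̄)`, there exists `ē ≠ 0` with
`det(τI_m + Ā′(ξ)) = ē·Δ̄(τ,ξ)` for all real `(τ,ξ)`. -/
theorem tangent_system_determinant {N d m : ℕ}
    (A : Fin d → Matrix (Fin N) (Fin N) ℂ)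
    (tb : ℝ) (xb : Fin d → ℝ)
    (hsemi : IsCompl
      (LinearMap.ker (Matrix.mulVecLin
        ((tb : ℂ) • (1 : Matrix (Fin N) (Fin N) ℂ) + ∑ j, (xb j : ℂ) • A j)))
      (LinearMap.range (Matrix.mulVecLin
        ((tb : ℂ) • (1 : Matrix (Fin N) (Fin N) ℂ) + ∑ j, (xb j : ℂ) • A j))))
    (hdim : Module.finrank ℂ
      (LinearMap.ker (Matrix.mulVecLin
        ((tb : ℂ) • (1 : Matrix (Fin N) (Fin N) ℂ) + ∑ j, (xb j : ℂ) • A j))) = m)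
    (V : Matrix (Fin N) (Fin m) ℂ)
    (hVmem : ∀ k : Fin m, (fun i => V i k) ∈
      LinearMap.ker (Matrix.mulVecLin
        ((tb : ℂ) • (1 : Matrix (Fin N) (Fin N) ℂ) + ∑ j, (xb j : ℂ) • A j)))
    (hVindep : LinearIndependent ℂ (fun k : Fin m => (fun i => V i k)))
    (W : Matrix (Fin m) (Fin N) ℂ)
    (hWV : W * V = 1)
    (hWrange : ∀ x ∈ LinearMap.range (Matrix.mulVecLin
        ((tb : ℂ) • (1 : Matrix (Fin N) (Fin N) ℂ) + ∑ j, (xb j : ℂ) • A j)),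
      W.mulVec x = 0) :
    ∃ e : ℂ, e ≠ 0 ∧ ∀ (τ : ℝ) (ξ : Fin d → ℝ),
      ((τ : ℂ) • (1 : Matrix (Fin m) (Fin m) ℂ) + ∑ j, (ξ j : ℂ) • (W * A j * V)).det
        = e * MvPolynomial.eval
            (fun i => ((Fin.cons τ ξ : Fin (d + 1) → ℝ) i : ℂ))
            (MvPolynomial.homogeneousComponent m
              (MvPolynomial.bind₁
                (fun i => MvPolynomial.X i
                  + MvPolynomial.C ((Fin.cons (tb : ℂ) (fun j => (xb j : ℂ))
                      : Fin (d + 1) → ℂ) i))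
                (charMvPoly A))) := by
  set L : Matrix (Fin N) (Fin N) ℂ :=
    (tb : ℂ) • (1 : Matrix (Fin N) (Fin N) ℂ) + ∑ j, (xb j : ℂ) • A j with hL
  have hLV : L * V = 0 := by
    ext i k
    exact congrFun (LinearMap.mem_ker.1 (hVmem k)) i
  have hWL : W * L = 0 := by
    refine Matrix.ext_of_mulVec_single fun j => ?_
    rw [← Matrix.mulVec_mulVec, Matrix.zero_mulVec]
    exact hWrange _ (LinearMap.mem_range_self L.mulVecLin _)
  have hker : LinearMap.range V.mulVecLin = LinearMap.ker L.mulVecLin := by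
    refine Submodule.eq_of_le_of_finrank_eq ?_ ?_
    · rw [Matrix.range_mulVecLin, Submodule.span_le]
      rintro _ ⟨k, rfl⟩
      exact hVmem k
    · rw [hdim, Matrix.range_mulVecLin]
      exact (finrank_span_eq_card hVindep).trans (Fintype.card_fin m)
  have hdet : (L + V * W).det ≠ 0 :=
    Matrix.det_add_mul_ne_zero L V W hsemi.disjoint hker hWV
  refine ⟨(L + V * W).det⁻¹, inv_ne_zero hdet, fun τ ξ => ?_⟩
  have hcoeff := Matrix.coeff_det_add_X_smul L
    ((τ : ℂ) • (1 : Matrix (Fin N) (Fin N) ℂ) + ∑ j, (ξ j : ℂ) • A j) V W hWV hLV hWL hdet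
  rw [Fintype.card_fin] at hcoeff
  rw [MvPolynomial.eval_homogeneousComponent, aeval_bind₁_charMvPoly]
  simp only [Fin.cons_zero, Fin.cons_succ]
  rw [← hL, hcoeff, inv_mul_cancel_left₀ hdet]
  congr 1
  simp only [Matrix.mul_add, Matrix.add_mul, Matrix.mul_smul, Matrix.smul_mul, Matrix.mul_one,
    Matrix.mul_sum, Matrix.sum_mul, hWV]
end

section
/- Let S ∈ M_N(ℂ) be Hermitian positive definite, and let A₁,…,A_d ∈ M_N(ℂ) be such that SA_j is Hermitian for every j and A_d is invertible. For τ ∈ ℝ, η ∈ ℝ^{d−1}, γ ∈ ℝ, set G := A_d^{−1}((τ − iγ)I + Σ_{j=1}^{d−1} η_jA_j). Let V be an N×m complex matrix and H an m×m complex matrix with GV = VH. Define Σ := −V*SA_dV. Then Σ is Hermitian and Im(ΣH) = γ·V*SV. In particular, if V is injective then V*SV is Hermitian positive definite, so for γ ≥ 0 one has Im(ΣH) ≥ cγI_m, where c > 0 is the smallest eigenvalue of V*SV. -/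
open Matrix
open scoped ComplexOrder

/-- A positive definite matrix is bounded below by a positive multiple of the identity. -/
theorem Matrix.PosDef.exists_pos_posSemidef_sub_smul_one {n : Type*} [Fintype n] [DecidableEq n]
    {M : Matrix n n ℂ} (hM : M.PosDef) :
    ∃ c : ℝ, 0 < c ∧ (M - (c : ℂ) • (1 : Matrix n n ℂ)).PosSemidef := by
  obtain ⟨c, hc, hle⟩ : ∃ c : ℝ, 0 < c ∧ ∀ i, c ≤ hM.1.eigenvalues i := by
    cases isEmpty_or_nonempty n with
    | inl _ => exact ⟨1, one_pos, isEmptyElim⟩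
    | inr _ =>
      obtain ⟨i, hi⟩ := Finite.exists_min hM.1.eigenvalues
      exact ⟨_, hM.eigenvalues_pos i, hi⟩
  refine ⟨c, hc, ?_⟩
  have hD : (diagonal (fun i => ((hM.1.eigenvalues i - c : ℝ) : ℂ))).PosSemidef :=
    .diagonal fun i => Complex.zero_le_real.2 (sub_nonneg.2 (hle i))
  have hsub : diagonal (fun i => ((hM.1.eigenvalues i - c : ℝ) : ℂ)) =
      diagonal (RCLike.ofReal ∘ hM.1.eigenvalues) - (c : ℂ) • (1 : Matrix n n ℂ) := by
    ext i j
    by_cases h : i = j <;> simp [h]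
  have key : M - (c : ℂ) • (1 : Matrix n n ℂ) =
      Unitary.conjStarAlgAut ℂ _ hM.1.eigenvectorUnitary
        (diagonal (fun i => ((hM.1.eigenvalues i - c : ℝ) : ℂ))) := by
    rw [hsub, map_sub, map_smul, map_one, ← hM.1.spectral_theorem]
  rw [key, Unitary.conjStarAlgAut_apply]
  exact hD.mul_mul_conjTranspose_same _

/-- If `SB - (SB)* = -2iγ S`, then the imaginary
part of `-V*SBV` is `γ V*SV`. -/
theorem matIm_neg_conjTranspose_mul_mul {N m : ℕ} {S B : Matrix (Fin N) (Fin N) ℂ}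
    (V : Matrix (Fin N) (Fin m) ℂ) (γ : ℂ)
    (h : S * B - (S * B)ᴴ = (-(2 * Complex.I) * γ) • S) :
    matIm (-(Vᴴ * (S * B) * V)) = γ • (Vᴴ * S * V) := by
  have hstar : (Vᴴ * (S * B) * V)ᴴ = Vᴴ * (S * B)ᴴ * V := by
    rw [conjTranspose_mul, conjTranspose_mul, conjTranspose_conjTranspose, Matrix.mul_assoc]
  have hdiff : -(Vᴴ * (S * B) * V) - (-(Vᴴ * (S * B) * V))ᴴ =
      ((2 * Complex.I) * γ) • (Vᴴ * S * V) := by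
    calc -(Vᴴ * (S * B) * V) - (-(Vᴴ * (S * B) * V))ᴴ
        = -(Vᴴ * (S * B - (S * B)ᴴ) * V) := by
          rw [conjTranspose_neg, hstar, Matrix.mul_sub, Matrix.sub_mul]
          abel
      _ = ((2 * Complex.I) * γ) • (Vᴴ * S * V) := by
          rw [h, Matrix.mul_smul, Matrix.smul_mul, ← neg_smul]
          ring_nf
  rw [matIm, hdiff, smul_smul, inv_mul_cancel_left₀ (by simp)]

/-- The anti-Hermitian part of `S((τ - iγ)I + ∑ η_j A_j)` for a Friedrichs symmetrizer `S`. -/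
theorem friedrichs_symbol_sub_conjTranspose {N d : ℕ} {S : Matrix (Fin N) (Fin N) ℂ}
    (hS : S.IsHermitian) {A : Fin d → Matrix (Fin N) (Fin N) ℂ}
    (hSA : ∀ j, (S * A j).IsHermitian) (τ γ : ℝ) (η : Fin d → ℝ) :
    S * (((τ : ℂ) - Complex.I * (γ : ℂ)) • (1 : Matrix (Fin N) (Fin N) ℂ)
        + ∑ j, (η j : ℂ) • A j)
      - (S * (((τ : ℂ) - Complex.I * (γ : ℂ)) • (1 : Matrix (Fin N) (Fin N) ℂ)
        + ∑ j, (η j : ℂ) • A j))ᴴ = (-(2 * Complex.I) * γ) • S := by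
  simp only [Matrix.mul_add, Matrix.mul_sum, Matrix.mul_smul, Matrix.mul_one, conjTranspose_add,
    conjTranspose_sum, conjTranspose_smul, hS.eq, (hSA _).eq, star_sub, star_mul',
    Complex.star_def, Complex.conj_ofReal, Complex.conj_I]
  rw [add_sub_add_right_eq_sub, ← sub_smul]
  ring_nf

/-- **Friedrichs symmetrizers yield block symmetrizers for the boundary symbol.**
Let `S` be Hermitian positive definite and `A₁,…,A_{d−1}` (the list `A`) and `A_d = Ad`
be such that `SA_j` is Hermitian for every `j` and `Ad` is invertible.  For real `τ, η, γ`
set `G := Ad⁻¹((τ − iγ)I + Σ_{j<d} η_j A_j)`.  Let `V` be `N×m`, `H` be `m×m` with `GV = VH`,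
and set `Σ := −V*S·Ad·V`.  Then `Σ` is Hermitian and `Im(ΣH) = γ·V*SV`.  In particular, if
`V` is injective then `V*SV` is positive definite and, with `c > 0` a lower bound of the
quadratic form of `V*SV` (e.g. its smallest eigenvalue), `Im(ΣH) ≥ cγI_m` whenever `γ ≥ 0`. -/
theorem friedrichs_block_symmetrizer {N d m : ℕ}
    (S : Matrix (Fin N) (Fin N) ℂ) (hS : S.PosDef)
    (A : Fin d → Matrix (Fin N) (Fin N) ℂ) (Ad : Matrix (Fin N) (Fin N) ℂ)
    (hSA : ∀ j, (S * A j).IsHermitian) (hSAd : (S * Ad).IsHermitian)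
    (hAd : IsUnit Ad.det)
    (τ γ : ℝ) (η : Fin d → ℝ)
    (V : Matrix (Fin N) (Fin m) ℂ) (H : Matrix (Fin m) (Fin m) ℂ)
    (hGV : (Ad⁻¹ * (((τ : ℂ) - Complex.I * (γ : ℂ)) • (1 : Matrix (Fin N) (Fin N) ℂ)
        + ∑ j, (η j : ℂ) • A j)) * V = V * H) :
    (-(Vᴴ * S * Ad * V)).IsHermitian ∧
    matIm ((-(Vᴴ * S * Ad * V)) * H) = (γ : ℂ) • (Vᴴ * S * V) ∧
    (Function.Injective (fun x : Fin m → ℂ => V.mulVec x) →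
      (Vᴴ * S * V).PosDef ∧
      ∃ c : ℝ, 0 < c ∧
        (∀ x : Fin m → ℂ,
          c * ∑ i, Complex.normSq (x i) ≤ (star x ⬝ᵥ (Vᴴ * S * V).mulVec x).re) ∧
        (0 ≤ γ →
          (matIm ((-(Vᴴ * S * Ad * V)) * H)
            - ((c * γ : ℝ) : ℂ) • (1 : Matrix (Fin m) (Fin m) ℂ)).PosSemidef)) := by
  have hIm : matIm ((-(Vᴴ * S * Ad * V)) * H) = (γ : ℂ) • (Vᴴ * S * V) := by
    rw [← matIm_neg_conjTranspose_mul_mul V γ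
      (friedrichs_symbol_sub_conjTranspose hS.1 hSA τ γ η), Matrix.neg_mul, Matrix.mul_assoc _ V H,
      ← hGV]
    simp only [Matrix.mul_assoc]
    rw [mul_nonsing_inv_cancel_left _ _ hAd]
  refine ⟨?_, hIm, fun hV => ?_⟩
  · rw [Matrix.mul_assoc Vᴴ S Ad]
    exact (isHermitian_conjTranspose_mul_mul V hSAd).neg
  · have hPD : (Vᴴ * S * V).PosDef := hS.conjTranspose_mul_mul_same hV
    obtain ⟨c, hc, hPSD⟩ := hPD.exists_pos_posSemidef_sub_smul_one
    refine ⟨hPD, c, hc, fun x => ?_, fun hγ => ?_⟩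
    · have h := (Complex.le_def.1 (hPSD.dotProduct_mulVec_nonneg x)).1
      have hnorm : (star x ⬝ᵥ x) = ((∑ i, Complex.normSq (x i) : ℝ) : ℂ) := by
        simp [dotProduct, Complex.normSq_eq_conj_mul_self]
      rw [sub_mulVec, smul_mulVec, one_mulVec, dotProduct_sub, dotProduct_smul, hnorm,
        smul_eq_mul, ← Complex.ofReal_mul, Complex.sub_re, Complex.ofReal_re,
        Complex.zero_re] at h
      linarith
    · have h := hPSD.smul (Complex.zero_le_real.2 hγ)
      rwa [smul_sub, smul_smul, ← Complex.ofReal_mul, mul_comm γ c, ← hIm] at h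
end
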